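/- arXiv:1207.4681 — 2 statements merged into one kernel-verified Lean document; each statement's English description precedes it below -/
import Mathlib

section
/- Let G be a finite simple graph on n vertices such that (i) every vertex of G has degree at least 1, (ii) any two distinct vertices of degree 1 are at distance at least 5 (there is no walk of length at most 4 joining them), and (iii) any two distinct vertices of degree 2 are at distance at least 2 (no two vertices of degree 2 are adjacent). Then G has a dominating set of size at most (3/7)·n. -/
set_option autoImplicit false
namespace NB
open Finset

variable {V : Type*} [DecidableEq V]

/-- The neighbours of `v` are exactly the two distinct vertices `a`, `b`. -/
def N2 (G : SimpleGraph V) (v a b : V) : Prop := a ≠ b ∧ ∀ z, G.Adj v z ↔ z = a ∨ z = b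

/-- A 4-cycle component of unmarked vertices. -/
def Exc4 (G : SimpleGraph V) (U : Finset V) (S : Finset V) : Prop :=
  ∃ a b c d, S = {a, b, c, d} ∧ a ∈ U ∧ b ∈ U ∧ c ∈ U ∧ d ∈ U ∧ a ≠ b ∧ a ≠ c ∧ a ≠ d ∧ b ≠ c ∧
    b ≠ d ∧ c ≠ d ∧ N2 G a d b ∧ N2 G b a c ∧ N2 G c b d ∧ N2 G d c a

/-- A 5-cycle with two nonadjacent marked vertices, the other three being unmarked of degree 2. -/
def Exc5 (G : SimpleGraph V) (U M : Finset V) (S : Finset V) : Prop :=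
  ∃ m n a b c, S = {m, n, a, b, c} ∧ m ∈ M ∧ n ∈ M ∧ a ∈ U ∧ b ∈ U ∧ c ∈ U ∧ m ≠ n ∧ a ≠ b ∧
    a ≠ c ∧ b ≠ c ∧ N2 G a m n ∧ N2 G b n c ∧ N2 G c b m

def Exc (G : SimpleGraph V) (U M : Finset V) (S : Finset V) : Prop := Exc4 G U S ∨ Exc5 G U M S

def pen (S : Finset V) : ℕ := if S.card = 4 then 2 else 1

structure Valid (G : SimpleGraph V) (U M : Finset V) : Prop where
  disj : ∀ v, v ∈ U → v ∈ M → False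
  mem : ∀ u v, G.Adj u v → u ∈ U ∨ u ∈ M
  deg : ∀ u ∈ U, ∃ a b, a ≠ b ∧ G.Adj u a ∧ G.Adj u b

def Good (G : SimpleGraph V) (U M : Finset V) : Prop :=
  ∃ (D : Finset V) (F : Finset (Finset V)), (∀ u ∈ U, u ∈ D ∨ ∃ x ∈ D, G.Adj x u) ∧
    (∀ S ∈ F, Exc G U M S) ∧ (∀ S ∈ F, ∀ T ∈ F, S ≠ T → Disjoint S T) ∧
    7 * D.card ≤ 3 * U.card + 2 * M.card + ∑ S ∈ F, pen S

def IH1 (U M : Finset V) : Prop :=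
  ∀ (G' : SimpleGraph V) (U' M' : Finset V), Valid G' U' M' → U'.card + M'.card < U.card + M.card →
    Good G' U' M'

def IH2 (G : SimpleGraph V) (U M : Finset V) : Prop :=
  ∀ (G' : SimpleGraph V), Valid G' U M → G' < G → Good G' U M

/-- remove all edges meeting `Y` -/
def del (G : SimpleGraph V) (Y : Finset V) : SimpleGraph V where
  Adj a b := G.Adj a b ∧ a ∉ Y ∧ b ∉ Y
  symm := ⟨fun a b h => ⟨h.1.symm, h.2.2, h.2.1⟩⟩
  loopless := ⟨fun a h => G.loopless.irrefl a h.1⟩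

theorem Exc5.pen_le {G : SimpleGraph V} {U M : Finset V} {S : Finset V} (hV : Valid G U M)
    (h : Exc5 G U M S) : pen S = 1 := by
  obtain ⟨m, n, a, b, c, rfl, hm, hn, ha, hb, hc, h1, h2, h3, h4, -⟩ := h
  have d := hV.disj
  have : ({m, n, a, b, c} : Finset V).card = 5 := by
    rw [card_insert_of_notMem, card_insert_of_notMem, card_insert_of_notMem,
      card_insert_of_notMem, card_singleton] <;> simp only [mem_insert, mem_singleton] <;> grind
  simp [pen, this]

theorem pen_le_two (S : Finset V) : pen S ≤ 2 := by unfold pen; split <;> omega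

theorem Exc.nonempty {G : SimpleGraph V} {U M : Finset V} {S : Finset V} (h : Exc G U M S) :
    S.Nonempty := by
  rcases h with ⟨a, b, c, d, rfl, -⟩ | ⟨a, b, c, d, e, rfl, -⟩ <;> exact ⟨a, by simp⟩

theorem Exc.sub {G : SimpleGraph V} {U M : Finset V} {S : Finset V} (h : Exc G U M S) :
    ∀ v ∈ S, v ∈ U ∨ v ∈ M := by
  rcases h with ⟨a, b, c, d, rfl, h⟩ | ⟨a, b, c, d, e, rfl, h⟩ <;> simp <;> grind

theorem pick {G : SimpleGraph V} {U M : Finset V} (hV : Valid G U M) (ih : IH1 U M)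
    (X YU YM T : Finset V) (F0 : Finset (Finset V)) (hYU : YU ⊆ U) (hYM : YM ⊆ M)
    (hne : (YU ∪ YM).Nonempty)
    (hdom : ∀ u ∈ U, (u ∈ YU ∨ ∃ y, (y ∈ YU ∨ y ∈ YM) ∧ G.Adj y u) → (u ∈ X ∨ ∃ x ∈ X, G.Adj x u))
    (hT : ∀ t ∈ T, t ∈ U ∧ t ∉ YU ∧ ∃ y s, (y ∈ YU ∨ y ∈ YM) ∧ N2 G t y s)
    (hF : ∀ S ∈ F0, Exc G U M S ∧ S ⊆ YU ∪ YM) (hFd : ∀ S ∈ F0, ∀ T ∈ F0, S ≠ T → Disjoint S T)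
    (hw : 7 * X.card ≤ 3 * YU.card + 2 * YM.card + T.card + ∑ S ∈ F0, pen S) :
    Good G U M := by
  classical
  set Y := YU ∪ YM with hY
  set N := U.filter (fun u => u ∉ Y ∧ ∃ y ∈ Y, G.Adj y u) with hN
  have dj := hV.disj
  have memY : ∀ v, v ∈ Y ↔ v ∈ YU ∨ v ∈ YM := by simp [hY]
  have memN : ∀ v, v ∈ N ↔ v ∈ U ∧ v ∉ Y ∧ ∃ y ∈ Y, G.Adj y v := by simp [hN]
  set U' := (U \ YU) \ N with hU'
  set M' := (M \ YM) ∪ N with hM'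
  have memU' : ∀ v, v ∈ U' ↔ v ∈ U ∧ v ∉ Y ∧ v ∉ N := by
    intro v; simp only [hU', mem_sdiff, memY]; have := @hYM v; have := dj v; tauto
  have memM' : ∀ v, v ∈ M' ↔ (v ∈ M ∧ v ∉ Y) ∨ v ∈ N := by
    intro v; simp only [hM', mem_union, mem_sdiff, memY]; have := @hYU v; have := dj v; tauto
  have cU : U'.card + N.card + YU.card = U.card := by
    have h1 := card_sdiff_add_card_eq_card hYU
    have h2 : N ⊆ U \ YU := by
      intro v hv; rw [memN] at hv; simp only [mem_sdiff]; rw [memY] at hv; tauto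
    have h3 := card_sdiff_add_card_eq_card h2
    rw [← hU'] at h3
    omega
  have cM : M'.card + YM.card = M.card + N.card := by
    have h1 := card_sdiff_add_card_eq_card hYM
    have h2 : Disjoint (M \ YM) N := by
      rw [Finset.disjoint_left]; intro v hv hv'; rw [memN] at hv'; simp only [mem_sdiff] at hv
      exact dj v hv'.1 hv.1
    have h3 : M'.card = _ := card_union_of_disjoint h2
    omega
  have cY : 0 < YU.card + YM.card := by
    have h1 := card_union_le YU YM
    have h2 := hne.card_pos
    rw [← hY] at h1
    omega
  have keep : ∀ u ∈ U', ∀ z, (del G Y).Adj u z ↔ G.Adj u z := by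
    intro u hu z
    rw [memU', memN] at hu
    simp only [del]
    constructor
    · exact fun h => h.1
    · intro h
      refine ⟨h, hu.2.1, fun hz => hu.2.2 ⟨hu.1, hu.2.1, z, hz, h.symm⟩⟩
  have hV' : Valid (del G Y) U' M' := by
    refine ⟨?_, ?_, ?_⟩
    · intro v h1 h2
      rw [memU'] at h1; rw [memM'] at h2
      have := dj v
      tauto
    · intro u v h
      rw [memU', memM']
      have := hV.mem u v h.1
      have := h.2.1
      tauto
    · intro u hu
      obtain ⟨a, b, hab, h1, h2⟩ := hV.deg u ((memU' u).1 hu).1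
      exact ⟨a, b, hab, (keep u hu a).2 h1, (keep u hu b).2 h2⟩
  obtain ⟨D, F, hD, hFe, hFdis, hcard⟩ := ih (del G Y) U' M' hV' (by omega)
  have keepN2 : ∀ u ∈ U', ∀ a b, N2 (del G Y) u a b → N2 G u a b := by
    intro u hu a b h
    refine ⟨h.1, fun z => ?_⟩
    rw [← keep u hu z]; exact h.2 z
  set F1 := F.filter (fun S => Exc G U M S) with hF1
  set F2 := F.filter (fun S => ¬ Exc G U M S) with hF2
  have hnew : ∀ S ∈ F2, pen S = 1 ∧ (S ∩ (N \ T)).Nonempty := by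
    intro S hS
    rw [hF2, mem_filter] at hS
    rcases hFe S hS.1 with h | h
    · exfalso
      apply hS.2
      left
      obtain ⟨a, b, c, d, e, h1, h2, h3, h4, k1, k2, k3, k4, k5, k6, l1, l2, l3, l4⟩ := h
      exact ⟨a, b, c, d, e, ((memU' _).1 h1).1, ((memU' _).1 h2).1, ((memU' _).1 h3).1,
        ((memU' _).1 h4).1, k1, k2, k3, k4, k5, k6, keepN2 _ h1 _ _ l1, keepN2 _ h2 _ _ l2,
        keepN2 _ h3 _ _ l3, keepN2 _ h4 _ _ l4⟩
    · refine ⟨h.pen_le hV', ?_⟩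
      obtain ⟨m, n, a, b, c, e, hm, hn, h1, h2, h3, k1, k2, k3, k4, l1, l2, l3⟩ := h
      have key : ∀ m ∈ M', m ∉ M → (∃ u v, u ∈ U' ∧ v ∈ U' ∧ u ≠ v ∧ (del G Y).Adj u m ∧ 
          (del G Y).Adj v m) → m ∈ N \ T := by
        rintro m hm hmM ⟨u, v, hu, hv, huv, h1, h2⟩
        rw [memM'] at hm
        rw [mem_sdiff]
        refine ⟨by tauto, fun hmT => ?_⟩
        obtain ⟨-, -, y, s, hy, -, hs⟩ := hT m hmT
        have e1 := (hs u).1 h1.1.symm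
        have e2 := (hs v).1 h2.1.symm
        have n1 : u ∉ Y := h1.2.1
        have n2 : v ∉ Y := h2.2.1
        rw [memY] at n1 n2
        grind
      by_cases hmM : m ∈ M
      · by_cases hnM : n ∈ M
        · exfalso
          apply hS.2
          right
          exact ⟨m, n, a, b, c, e, hmM, hnM, ((memU' _).1 h1).1, ((memU' _).1 h2).1,
            ((memU' _).1 h3).1, k1, k2, k3, k4, keepN2 _ h1 _ _ l1, keepN2 _ h2 _ _ l2,
            keepN2 _ h3 _ _ l3⟩
        · refine ⟨n, mem_inter.2 ⟨by simp [e], key n hn hnM ⟨a, b, h1, h2, k2, ?_, ?_⟩⟩⟩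
          · exact (l1.2 _).2 (Or.inr rfl)
          · exact (l2.2 _).2 (Or.inl rfl)
      · refine ⟨m, mem_inter.2 ⟨by simp [e], key m hm hmM ⟨a, c, h1, h3, k3, ?_, ?_⟩⟩⟩
        · exact (l1.2 _).2 (Or.inl rfl)
        · exact (l3.2 _).2 (Or.inr rfl)
  have hTN : T ⊆ N := by
    intro t ht
    obtain ⟨h1, h2, y, s, hy, -, hs⟩ := hT t ht
    rw [memN, memY]
    refine ⟨h1, ?_, y, (memY y).2 hy, ((hs y).2 (Or.inl rfl)).symm⟩
    have := @hYM t
    have := dj t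
    tauto
  have cT := card_sdiff_add_card_eq_card hTN
  have c2 : F2.card ≤ (N \ T).card := by
    have hb : (F2.biUnion (fun S => S ∩ (N \ T))).card = ∑ S ∈ F2, (S ∩ (N \ T)).card := by
      apply card_biUnion
      intro S hS S' hS' hne
      have := hFdis S (mem_of_mem_filter _ hS) S' (mem_of_mem_filter _ hS') hne
      exact Disjoint.mono inter_subset_left inter_subset_left this
    have hs : F2.card ≤ ∑ S ∈ F2, (S ∩ (N \ T)).card := by
      rw [card_eq_sum_ones]
      exact sum_le_sum fun S hS => (hnew S hS).2.card_pos
    have hsub : (F2.biUnion (fun S => S ∩ (N \ T))).card ≤ (N \ T).card := by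
      apply card_le_card
      intro v hv
      simp only [mem_biUnion] at hv
      obtain ⟨S, -, hv⟩ := hv
      exact (mem_inter.1 hv).2
    omega
  have s2 : ∑ S ∈ F2, pen S = F2.card := by
    rw [card_eq_sum_ones]
    exact sum_congr rfl fun S hS => (hnew S hS).1
  have s12 : ∑ S ∈ F1, pen S + ∑ S ∈ F2, pen S = ∑ S ∈ F, pen S :=
    sum_filter_add_sum_filter_not _ _ _
  have dF : ∀ S ∈ F1, ∀ S' ∈ F0, Disjoint S S' := by
    intro S hS S' hS'
    have h1 := (hFe S (mem_of_mem_filter _ hS)).sub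
    have h2 := (hF S' hS').2
    rw [Finset.disjoint_left]
    intro v hv hv'
    have h3 := h1 v hv
    have h4 := h2 hv'
    rw [memU', memM', memN] at h3
    tauto
  have dF' : Disjoint F1 F0 := by
    rw [Finset.disjoint_left]
    intro S h1 h2
    have h3 := dF S h1 S h2
    have h4 := (hF S h2).1.nonempty
    rw [disjoint_self] at h3
    exact h4.ne_empty h3
  refine ⟨D ∪ X, F1 ∪ F0, ?_, ?_, ?_, ?_⟩
  · intro u hu
    by_cases h : u ∈ YU ∨ ∃ y, (y ∈ YU ∨ y ∈ YM) ∧ G.Adj y u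
    · rcases hdom u hu h with h | ⟨x, hx, hxu⟩
      · left; simp [h]
      · right; exact ⟨x, by simp [hx], hxu⟩
    · have hu' : u ∈ U' := by
        rw [memU', memN]
        have := @hYM u
        have := dj u
        simp only [memY]
        rw [not_or] at h
        refine ⟨hu, by tauto, fun h' => h.2 h'.2.2⟩
      rcases hD u hu' with h | ⟨x, hx, hxu⟩
      · left; simp [h]
      · right; exact ⟨x, by simp [hx], hxu.1⟩
  · intro S hS
    rcases mem_union.1 hS with h | h
    · exact (mem_filter.1 h).2
    · exact (hF S h).1
  · intro S hS S' hS' hne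
    rcases mem_union.1 hS with h | h <;> rcases mem_union.1 hS' with h' | h'
    · exact hFdis S (mem_of_mem_filter _ h) S' (mem_of_mem_filter _ h') hne
    · exact dF S h S' h'
    · exact (dF S' h' S h).symm
    · exact hFd S h S' h' hne
  · rw [sum_union dF']
    have := card_union_le D X
    omega

theorem pickL {G : SimpleGraph V} {U M : Finset V} (hV : Valid G U M) (ih : IH1 U M)
    (X YU YM T : List V) (hYU : ∀ y ∈ YU, y ∈ U) (hYM : ∀ y ∈ YM, y ∈ M)
    (h1 : YU.Nodup) (h2 : YM.Nodup) (h3 : T.Nodup)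
    (hw : 7 * X.length ≤ 3 * YU.length + 2 * YM.length + T.length)
    (hne : 0 < YU.length + YM.length)
    (hdom : ∀ u ∈ U, (u ∈ YU ∨ ∃ y, (y ∈ YU ∨ y ∈ YM) ∧ G.Adj y u) → (u ∈ X ∨ ∃ x ∈ X, G.Adj x u))
    (hT : ∀ t ∈ T, t ∈ U ∧ t ∉ YU ∧ ∃ y s, (y ∈ YU ∨ y ∈ YM) ∧ N2 G t y s) :
    Good G U M := by
  refine pick hV ih X.toFinset YU.toFinset YM.toFinset T.toFinset ∅ ?_ ?_ ?_ ?_ ?_ ?_ ?_ ?_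
  · intro v hv; exact hYU v (by simpa using hv)
  · intro v hv; exact hYM v (by simpa using hv)
  · rw [← card_pos]
    rcases Nat.eq_zero_or_pos YU.length with h | h
    · have : 0 < YM.toFinset.card := by rw [List.toFinset_card_of_nodup h2]; omega
      exact this.trans_le (card_le_card subset_union_right)
    · have : 0 < YU.toFinset.card := by rw [List.toFinset_card_of_nodup h1]; omega
      exact this.trans_le (card_le_card subset_union_left)
  · simpa using hdom
  · simpa using hT
  · simp
  · simp
  · rw [List.toFinset_card_of_nodup h1, List.toFinset_card_of_nodup h2,
      List.toFinset_card_of_nodup h3]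
    have := X.toFinset_card_le
    simp; omega


/-- Remove `a,b,c`, and join `x`, `y`. -/
def contr (G : SimpleGraph V) (a b c x y : V) : SimpleGraph V where
  Adj p q := (G.Adj p q ∧ (p ≠ a ∧ p ≠ b ∧ p ≠ c) ∧ (q ≠ a ∧ q ≠ b ∧ q ≠ c)) ∨
    (x ≠ y ∧ ((p = x ∧ q = y) ∨ (p = y ∧ q = x)))
  symm := ⟨by
    rintro p q (h | h)
    · exact Or.inl ⟨h.1.symm, h.2.2, h.2.1⟩
    · exact Or.inr (by tauto)⟩
  loopless := ⟨by
    rintro p (h | h)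
    · exact G.loopless.irrefl p h.1
    · grind⟩

theorem contract {G : SimpleGraph V} {U M : Finset V} (hV : Valid G U M) (ih : IH1 U M)
    {a b c x y : V} (ha : a ∈ U) (hb : b ∈ U) (hc : c ∈ U) (na : N2 G a x b) (nb : N2 G b a c)
    (nc : N2 G c b y) (hxc : x ≠ c) (hya : y ≠ a)
    (h : (x ≠ y ∧ ¬ G.Adj x y) ∨ (x = y ∧ (x ∈ U → ∃ p q, p ≠ q ∧ p ≠ a ∧ p ≠ c ∧ q ≠ a ∧ q ≠ c ∧
      G.Adj x p ∧ G.Adj x q))) : Good G U M := by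
  classical
  have symm : ∀ p q, G.Adj p q → G.Adj q p := fun p q h => h.symm
  have irr : ∀ p, ¬ G.Adj p p := fun p => G.loopless.irrefl p
  have dj := hV.disj
  have hmem := hV.mem
  have nbc : b ≠ c := by have := irr b; have := nb.2; grind
  have nab : a ≠ b := by have := irr b; have := nb.2; grind
  have nac : a ≠ c := nb.1
  have hax : G.Adj a x := (na.2 x).2 (Or.inl rfl)
  have hcy : G.Adj c y := (nc.2 y).2 (Or.inr rfl)
  have hxa : x ≠ a := fun h => irr a (h ▸ hax)
  have hyc : y ≠ c := fun h => irr c (h ▸ hcy)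
  have hxb : x ≠ b := na.1
  have hyb : y ≠ b := nc.1.symm
  set G' := contr G a b c x y with hG'
  have adj' : ∀ p q, G'.Adj p q ↔ (G.Adj p q ∧ (p ≠ a ∧ p ≠ b ∧ p ≠ c) ∧ (q ≠ a ∧ q ≠ b ∧ q ≠ c)) ∨
    (x ≠ y ∧ ((p = x ∧ q = y) ∨ (p = y ∧ q = x))) := fun p q => Iff.rfl
  set U' := U \ {a, b, c} with hU'
  have memU' : ∀ v, v ∈ U' ↔ v ∈ U ∧ v ≠ a ∧ v ≠ b ∧ v ≠ c := by
    intro v; simp [hU']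
  have cU : U'.card + 3 = U.card := by
    have h1 : ({a, b, c} : Finset V) ⊆ U := by
      intro v; simp only [mem_insert, mem_singleton]; grind
    have h2 := card_sdiff_add_card_eq_card h1
    have h3 : ({a, b, c} : Finset V).card = 3 := by
      rw [card_eq_three]; exact ⟨a, b, c, nab, nac, nbc, rfl⟩
    rw [← hU'] at h2
    omega
  obtain ⟨-, na⟩ := na
  obtain ⟨-, nb⟩ := nb
  obtain ⟨-, nc⟩ := nc
  have keep : ∀ u, u ≠ a → u ≠ b → u ≠ c → u ≠ x → u ≠ y → ∀ z, G'.Adj u z ↔ G.Adj u z := by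
    intro u h1 h2 h3 h4 h5 z
    rw [adj']
    have := symm u z
    have := na u
    have := nb u
    have := nc u
    grind
  have hV' : Valid G' U' M := by
    refine ⟨?_, ?_, ?_⟩
    · intro v h1 h2
      exact dj v ((memU' v).1 h1).1 h2
    · intro u v h
      rw [memU']
      rw [adj'] at h
      have := hmem u v
      have := hmem x a (symm _ _ hax)
      have := hmem y c (symm _ _ hcy)
      grind
    · intro u hu
      have hu' := (memU' u).1 hu
      obtain ⟨p, q, hpq, h1, h2⟩ := hV.deg u hu'.1
      by_cases hux : u = x
      · subst hux
        rcases h with ⟨h3, h4⟩ | ⟨h3, h4⟩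
        · have : ∃ r, r ≠ a ∧ G.Adj u r := by
            by_cases h : p = a
            · exact ⟨q, by grind, h2⟩
            · exact ⟨p, h, h1⟩
          obtain ⟨r, hr, hr'⟩ := this
          refine ⟨y, r, by grind, by rw [adj']; grind, ?_⟩
          rw [adj']
          have := nb u
          have := nc u
          have := symm u r hr'
          grind
        · obtain ⟨p, q, k1, k2, k3, k4, k5, k6, k7⟩ := h4 hu'.1
          refine ⟨p, q, k1, ?_, ?_⟩ <;> rw [adj']
          · have := nb u
            have := symm u p k6
            grind
          · have := nb u
            have := symm u q k7
            grind
      · by_cases huy : u = y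
        · subst huy
          rcases h with ⟨h3, h4⟩ | ⟨h3, h4⟩
          · have : ∃ r, r ≠ c ∧ G.Adj u r := by
              by_cases h : p = c
              · exact ⟨q, by grind, h2⟩
              · exact ⟨p, h, h1⟩
            obtain ⟨r, hr, hr'⟩ := this
            have := symm u r hr'
            refine ⟨x, r, by grind, by rw [adj']; grind, ?_⟩
            rw [adj']
            have := nb u
            have := na u
            grind
          · exact absurd h3.symm hux
        · have := keep u hu'.2.1 hu'.2.2.1 hu'.2.2.2 hux huy
          exact ⟨p, q, hpq, (this p).2 h1, (this q).2 h2⟩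
  have N2' : ∀ u ∈ U', ∀ p q, N2 G' u p q → N2 G u p q ∨
      ((x = u ∨ x = p ∨ x = q) ∧ (y = u ∨ y = p ∨ y = q)) := by
    intro u hu p q hN
    have hu' := (memU' u).1 hu
    by_cases hux : u = x
    · right
      have := hN.2 y
      rw [adj'] at this
      grind
    · by_cases huy : u = y
      · right
        have := hN.2 x
        rw [adj'] at this
        grind
      · left
        refine ⟨hN.1, fun z => ?_⟩
        rw [← keep u hu'.2.1 hu'.2.2.1 hu'.2.2.2 hux huy]
        exact hN.2 z
  have hexc : ∀ S, Exc G' U' M S → Exc G U M S ∨ (x ∈ S ∧ y ∈ S) := by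
    rintro S (⟨p, q, r, s, e, h1, h2, h3, h4, k1, k2, k3, k4, k5, k6, l1, l2, l3, l4⟩ |
      ⟨m, n, p, q, r, e, hm, hn, h1, h2, h3, k1, k2, k3, k4, l1, l2, l3⟩)
    · by_cases hS : x ∈ S ∧ y ∈ S
      · exact Or.inr hS
      · left; left
        have g1 := N2' _ h1 _ _ l1
        have g2 := N2' _ h2 _ _ l2
        have g3 := N2' _ h3 _ _ l3
        have g4 := N2' _ h4 _ _ l4
        subst e
        simp only [mem_insert, mem_singleton] at hS
        simp only [memU'] at h1 h2 h3 h4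
        refine ⟨p, q, r, s, rfl, h1.1, h2.1, h3.1, h4.1, k1, k2, k3, k4, k5, k6, ?_, ?_, ?_, ?_⟩
        · rcases g1 with g | g; exacts [g, by grind]
        · rcases g2 with g | g; exacts [g, by grind]
        · rcases g3 with g | g; exacts [g, by grind]
        · rcases g4 with g | g; exacts [g, by grind]
    · by_cases hS : x ∈ S ∧ y ∈ S
      · exact Or.inr hS
      · left; right
        have g1 := N2' _ h1 _ _ l1
        have g2 := N2' _ h2 _ _ l2
        have g3 := N2' _ h3 _ _ l3
        subst e
        simp only [mem_insert, mem_singleton] at hS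
        simp only [memU'] at h1 h2 h3
        refine ⟨m, n, p, q, r, rfl, hm, hn, h1.1, h2.1, h3.1, k1, k2, k3, k4, ?_, ?_, ?_⟩
        · rcases g1 with g | g; exacts [g, by grind]
        · rcases g2 with g | g; exacts [g, by grind]
        · rcases g3 with g | g; exacts [g, by grind]
  obtain ⟨D, F, hD, hFe, hFdis, hcard⟩ := ih G' U' M hV' (by omega)
  set F1 := F.filter (fun S => Exc G U M S) with hF1
  set F2 := F.filter (fun S => ¬ Exc G U M S) with hF2
  have s12 : ∑ S ∈ F1, pen S + ∑ S ∈ F2, pen S = ∑ S ∈ F, pen S :=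
    sum_filter_add_sum_filter_not _ _ _
  have c2 : F2.card ≤ 1 := by
    rw [card_le_one]
    intro S hS S' hS'
    rw [hF2, mem_filter] at hS hS'
    by_contra hne
    have h1 := hFdis S hS.1 S' hS'.1 hne
    have h2 := hexc S (hFe S hS.1)
    have h3 := hexc S' (hFe S' hS'.1)
    rw [Finset.disjoint_left] at h1
    have := @h1 x
    tauto
  have s2 : ∑ S ∈ F2, pen S ≤ 2 := by
    have : ∑ S ∈ F2, pen S ≤ F2.card • 2 := sum_le_card_nsmul _ _ _ fun S _ => pen_le_two S
    simp only [smul_eq_mul] at this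
    omega
  have hba : G.Adj b a := (nb a).2 (Or.inl rfl)
  have hbc : G.Adj b c := (nb c).2 (Or.inr rfl)
  have fin : ∀ d, (∀ u ∈ U, u ∈ insert d D ∨ ∃ x ∈ insert d D, G.Adj x u) → Good G U M := by
    intro d hd
    refine ⟨insert d D, F1, hd, fun S hS => (mem_filter.1 hS).2, fun S hS S' hS' =>
      hFdis S (mem_of_mem_filter _ hS) S' (mem_of_mem_filter _ hS'), ?_⟩
    have := card_insert_le d D
    omega
  have gen : ∀ d, (a = d ∨ G.Adj d a ∨ x ∈ D) → (b = d ∨ G.Adj d b) → (c = d ∨ G.Adj d c ∨ y ∈ D) →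
      (x ∈ D → x ≠ y → G.Adj d y) → (y ∈ D → x ≠ y → G.Adj d x ∨ x ∈ D) → Good G U M := by
    intro d h1 h2 h3 h4 h5
    apply fin d
    simp only [mem_insert]
    intro u hu
    by_cases hua : u = a
    · subst hua
      have := symm u x hax
      grind
    by_cases hub : u = b
    · subst hub
      grind
    by_cases huc : u = c
    · subst huc
      have := symm u y hcy
      grind
    rcases hD u ((memU' u).2 ⟨hu, hua, hub, huc⟩) with h | ⟨v, hv, hvu⟩
    · left; right; exact h
    · rw [adj'] at hvu
      rcases hvu with h | ⟨h, ⟨rfl, rfl⟩ | ⟨rfl, rfl⟩⟩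
      · right; exact ⟨v, Or.inr hv, h.1⟩
      · right; exact ⟨d, Or.inl rfl, h4 hv h⟩
      · rcases h5 hv h with h | h
        · right; exact ⟨d, Or.inl rfl, h⟩
        · left; right; exact h
  by_cases hx : x ∈ D
  · exact gen c (Or.inr (Or.inr hx)) (Or.inr hbc.symm) (Or.inl rfl) (fun _ _ => hcy)
      (fun _ _ => Or.inr hx)
  · by_cases hy : y ∈ D
    · exact gen a (Or.inl rfl) (Or.inr hba.symm) (Or.inr (Or.inr hy)) (fun h => absurd h hx)
        (fun _ _ => Or.inl hax)
    · exact gen b (Or.inr (Or.inl hba)) (Or.inl rfl) (Or.inr (Or.inl hbc)) (fun h => absurd h hx)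
        (fun h => absurd h hy)

/-- Remove the edge `xy`. -/
def del1 (G : SimpleGraph V) (x y : V) : SimpleGraph V where
  Adj p q := G.Adj p q ∧ ¬ (p = x ∧ q = y) ∧ ¬ (p = y ∧ q = x)
  symm := ⟨fun p q h => ⟨h.1.symm, by tauto, by tauto⟩⟩
  loopless := ⟨fun p h => G.loopless.irrefl p h.1⟩

theorem del1_comm (G : SimpleGraph V) (x y : V) : del1 G x y = del1 G y x := by
  ext p q; simp only [del1]; tauto

theorem N2.symm {G : SimpleGraph V} {v a b : V} (h : N2 G v a b) : N2 G v b a :=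
  ⟨h.1.symm, fun z => (h.2 z).trans or_comm⟩

theorem N2.of_del1 {G : SimpleGraph V} {x y v a b : V} (h : N2 (del1 G x y) v a b) (hx : v ≠ x)
    (hy : v ≠ y) : N2 G v a b := by
  refine ⟨h.1, fun z => ?_⟩
  rw [← h.2 z]; simp only [del1]; tauto

theorem N2.del1_left {G : SimpleGraph V} {x y a b : V} (h : N2 (del1 G x y) x a b)
    (hxy : G.Adj x y) : y ≠ a ∧ y ≠ b ∧ ∀ z, G.Adj x z ↔ z = a ∨ z = b ∨ z = y := by
  have h1 := h.2
  simp only [del1] at h1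
  have := G.loopless.irrefl x
  refine ⟨?_, ?_, fun z => ?_⟩
  · have := h1 a; grind
  · have := h1 b; grind
  · have := h1 z; grind

def Conf (G : SimpleGraph V) (U M : Finset V) (x y : V) : Prop :=
  (∃ a b c, x ∈ U ∧ a ∈ U ∧ b ∈ U ∧ c ∈ U ∧ x ≠ a ∧ x ≠ b ∧ x ≠ c ∧ a ≠ b ∧ a ≠ c ∧ b ≠ c ∧
    N2 (del1 G x y) x a c ∧ N2 (del1 G x y) a x b ∧ N2 (del1 G x y) b a c ∧
    N2 (del1 G x y) c b x) ∨
  (∃ m n b c, m ∈ M ∧ n ∈ M ∧ x ∈ U ∧ b ∈ U ∧ c ∈ U ∧ m ≠ n ∧ x ≠ b ∧ x ≠ c ∧ b ≠ c ∧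
    N2 (del1 G x y) x m n ∧ N2 (del1 G x y) b n c ∧ N2 (del1 G x y) c b m) ∨
  (∃ m n a c, m ∈ M ∧ n ∈ M ∧ a ∈ U ∧ x ∈ U ∧ c ∈ U ∧ m ≠ n ∧ a ≠ x ∧ a ≠ c ∧ x ≠ c ∧
    N2 (del1 G x y) a m n ∧ N2 (del1 G x y) x n c ∧ N2 (del1 G x y) c x m)

theorem exc4_conf {G : SimpleGraph V} {U M : Finset V} {x y : V} {S : Finset V}
    (h : Exc4 (del1 G x y) U S) (hx : x ∈ S) : Conf G U M x y := by
  obtain ⟨p, q, r, s, rfl, h1, h2, h3, h4, k1, k2, k3, k4, k5, k6, l1, l2, l3, l4⟩ := h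
  simp only [mem_insert, mem_singleton] at hx
  left
  rcases hx with rfl | rfl | rfl | rfl
  · exact ⟨q, r, s, h1, h2, h3, h4, k1, k2, k3, k4, k5, k6, l1.symm, l2, l3, l4⟩
  · exact ⟨r, s, p, h2, h3, h4, h1, k4, k5, k1.symm, k6, k2.symm, k3.symm, l2.symm, l3, l4, l1⟩
  · exact ⟨s, p, q, h3, h4, h1, h2, k6, k2.symm, k4.symm, k3.symm, k5.symm, k1, l3.symm, l4, l1, l2⟩
  · exact ⟨p, q, r, h4, h1, h2, h3, k3.symm, k5.symm, k6.symm, k1, k2, k4, l4.symm, l1, l2, l3⟩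

theorem edge_conf {G : SimpleGraph V} {U M : Finset V} (hV : Valid G U M) (ih : IH2 G U M)
    (hbad : ¬ Good G U M) {x y : V} (hxy : G.Adj x y) (hx : x ∈ U → ∀ p q, ¬ N2 G x p q)
    (hy : y ∈ U → ∀ p q, ¬ N2 G y p q) : Conf G U M x y ∨ Conf G U M y x := by
  by_contra hno
  rw [not_or] at hno
  apply hbad
  have third : ∀ v ∈ U, (∀ p q, ¬ N2 G v p q) → ∀ w, ∃ p q, p ≠ q ∧ p ≠ w ∧ q ≠ w ∧ G.Adj v p ∧
      G.Adj v q := by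
    intro v hv hvn w
    obtain ⟨p, q, hpq, hp, hq⟩ := hV.deg v hv
    have : ∃ r, G.Adj v r ∧ r ≠ p ∧ r ≠ q := by
      by_contra hcon
      push Not at hcon
      apply hvn p q
      refine ⟨hpq, fun z => ⟨fun hz => ?_, fun hz => ?_⟩⟩
      · have := hcon z hz; tauto
      · rcases hz with rfl | rfl <;> assumption
    obtain ⟨r, hr, h1, h2⟩ := this
    by_cases hpw : p = w
    · exact ⟨q, r, h2.symm, by grind, by grind, hq, hr⟩
    · by_cases hqw : q = w
      · exact ⟨p, r, h1.symm, hpw, by grind, hp, hr⟩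
      · exact ⟨p, q, hpq, hpw, hqw, hp, hq⟩
  have hV' : Valid (del1 G x y) U M := by
    refine ⟨hV.disj, fun u v h => hV.mem u v h.1, fun u hu => ?_⟩
    by_cases h1 : u = x
    · subst h1
      obtain ⟨p, q, k1, k2, k3, k4, k5⟩ := third u hu (hx hu) y
      refine ⟨p, q, k1, ⟨k4, ?_⟩, ⟨k5, ?_⟩⟩ <;> grind [G.loopless.irrefl u]
    · by_cases h2 : u = y
      · subst h2
        obtain ⟨p, q, k1, k2, k3, k4, k5⟩ := third u hu (hy hu) x
        refine ⟨p, q, k1, ⟨k4, ?_⟩, ⟨k5, ?_⟩⟩ <;> grind [G.loopless.irrefl u]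
      · obtain ⟨p, q, hpq, hp, hq⟩ := hV.deg u hu
        exact ⟨p, q, hpq, ⟨hp, by tauto, by tauto⟩, ⟨hq, by tauto, by tauto⟩⟩
  have hlt : del1 G x y < G := by
    refine lt_of_le_of_ne (fun u v h => h.1) fun h => ?_
    have : (del1 G x y).Adj x y := by rw [h]; exact hxy
    exact this.2.1 ⟨rfl, rfl⟩
  obtain ⟨D, F, hD, hFe, hFdis, hcard⟩ := ih _ hV' hlt
  refine ⟨D, F, ?_, ?_, hFdis, hcard⟩
  · intro u hu
    rcases hD u hu with h | ⟨v, hv, h⟩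
    · exact Or.inl h
    · exact Or.inr ⟨v, hv, h.1⟩
  · intro S hS
    rcases hFe S hS with h | h
    · by_cases hxS : x ∈ S
      · exact absurd (exc4_conf h hxS) hno.1
      by_cases hyS : y ∈ S
      · rw [del1_comm] at h
        exact absurd (exc4_conf h hyS) hno.2
      left
      obtain ⟨p, q, r, s, rfl, h1, h2, h3, h4, k1, k2, k3, k4, k5, k6, l1, l2, l3, l4⟩ := h
      simp only [mem_insert, mem_singleton, not_or] at hxS hyS
      refine ⟨p, q, r, s, rfl, h1, h2, h3, h4, k1, k2, k3, k4, k5, k6, l1.of_del1 ?_ ?_,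
        l2.of_del1 ?_ ?_, l3.of_del1 ?_ ?_, l4.of_del1 ?_ ?_⟩ <;> grind
    · right
      have key : ∀ x y, Exc5 (del1 G x y) U M S → ¬ Conf G U M x y → ∃ m n a b c,
          S = {m, n, a, b, c} ∧ m ∈ M ∧ n ∈ M ∧ a ∈ U ∧ b ∈ U ∧ c ∈ U ∧ m ≠ n ∧ a ≠ b ∧
          a ≠ c ∧ b ≠ c ∧ N2 (del1 G x y) a m n ∧ N2 (del1 G x y) b n c ∧ N2 (del1 G x y) c b m ∧
          a ≠ x ∧ b ≠ x ∧ c ≠ x := by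
        rintro x y ⟨m, n, a, b, c, rfl, hm, hn, h1, h2, h3, k1, k2, k3, k4, l1, l2, l3⟩ hno
        refine ⟨m, n, a, b, c, rfl, hm, hn, h1, h2, h3, k1, k2, k3, k4, l1, l2, l3, ?_, ?_, ?_⟩
        · rintro rfl
          exact hno (Or.inr (Or.inl ⟨m, n, b, c, hm, hn, h1, h2, h3, k1, k2, k3, k4, l1, l2, l3⟩))
        · rintro rfl
          exact hno (Or.inr (Or.inr ⟨m, n, a, c, hm, hn, h1, h2, h3, k1, k2, k3, k4, l1, l2, l3⟩))
        · rintro rfl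
          exact hno (Or.inr (Or.inr ⟨n, m, a, b, hn, hm, h1, h3, h2, k1.symm, k3, k2, k4.symm,
            l1.symm, l3.symm, l2.symm⟩))
      obtain ⟨m, n, a, b, c, rfl, hm, hn, h1, h2, h3, k1, k2, k3, k4, l1, l2, l3, q1, q2, q3⟩ :=
        key x y h hno.1
      have hay : a ≠ y ∧ b ≠ y ∧ c ≠ y := by
        refine ⟨?_, ?_, ?_⟩
        · rintro rfl
          rw [del1_comm] at l1 l2 l3
          exact hno.2 (Or.inr (Or.inl ⟨m, n, b, c, hm, hn, h1, h2, h3, k1, k2, k3, k4, l1, l2, l3⟩))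
        · rintro rfl
          rw [del1_comm] at l1 l2 l3
          exact hno.2 (Or.inr (Or.inr ⟨m, n, a, c, hm, hn, h1, h2, h3, k1, k2, k3, k4, l1, l2, l3⟩))
        · rintro rfl
          rw [del1_comm] at l1 l2 l3
          exact hno.2 (Or.inr (Or.inr ⟨n, m, a, b, hn, hm, h1, h3, h2, k1.symm, k3, k2, k4.symm,
            l1.symm, l3.symm, l2.symm⟩))
      exact ⟨m, n, a, b, c, rfl, hm, hn, h1, h2, h3, k1, k2, k3, k4, l1.of_del1 q1 hay.1,
        l2.of_del1 q2 hay.2.1, l3.of_del1 q3 hay.2.2⟩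

theorem killC4 {G : SimpleGraph V} {U M : Finset V} (hV : Valid G U M) (ih : IH1 U M)
    {x a b c y : V} (hx : x ∈ U) (ha : a ∈ U) (hb : b ∈ U) (hc : c ∈ U) (d1 : x ≠ a) (d2 : x ≠ b)
    (d3 : x ≠ c) (d4 : a ≠ b) (d5 : a ≠ c) (d6 : b ≠ c) (hy : y ≠ a ∧ y ≠ b ∧ y ≠ c)
    (nx : ∀ z, G.Adj x z ↔ z = a ∨ z = c ∨ z = y) (na : N2 G a x b)
    (nb : N2 G b a c) (nc : N2 G c b x) : Good G U M := by
  have symm : ∀ p q, G.Adj p q → G.Adj q p := fun p q h => h.symm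
  have hxy : G.Adj x y := (nx y).2 (by simp)
  have hyx := hxy.symm
  have hne : y ≠ x := hxy.ne'
  have na := na.2
  have nb := nb.2
  have nc := nc.2
  rcases hV.mem y x hyx with hyU | hyM
  · refine pickL hV ih [b, y] [x, a, b, c, y] [] [] ?_ ?_ ?_ ?_ ?_ ?_ ?_ ?_ ?_ <;> simp <;> grind
  · refine pickL hV ih [b, y] [x, a, b, c] [y] [] ?_ ?_ ?_ ?_ ?_ ?_ ?_ ?_ ?_ <;> simp <;> grind

theorem kill_conf {G : SimpleGraph V} {U M : Finset V} (hV : Valid G U M) (ih : IH1 U M)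
    (ih2 : IH2 G U M) {x y : V} (hxy : G.Adj x y) (hx : x ∈ U → ∀ p q, ¬ N2 G x p q)
    (hy : y ∈ U → ∀ p q, ¬ N2 G y p q) (hconf : Conf G U M x y) : Good G U M := by
  by_contra hbad
  have symm : ∀ p q, G.Adj p q → G.Adj q p := fun p q h => h.symm
  have hyx := hxy.symm
  have hne : y ≠ x := hxy.ne'
  have dj := hV.disj
  rcases hconf with ⟨a, b, c, hxU, ha, hb, hc, d1, d2, d3, d4, d5, d6, l1, l2, l3, l4⟩ |
    ⟨m, n, b, c, hm, hn, hxU, hb, hc, d1, d2, d3, d4, l1, l2, l3⟩ |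
    ⟨m, n, a, c, hm, hn, ha, hxU, hc, d1, d2, d3, d4, l1, l2, l3⟩
  · obtain ⟨e1, e2, nx⟩ := l1.del1_left hxy
    have na := l2.of_del1 d1.symm e1.symm
    have nc := l4.of_del1 d3.symm e2.symm
    by_cases hby : b = y
    · subst hby
      rw [del1_comm] at l3
      obtain ⟨-, -, nb⟩ := l3.del1_left hyx
      have na := na.2
      have nc := nc.2
      apply hbad
      refine pickL hV ih [x] [x, a, b, c] [] [] ?_ ?_ ?_ ?_ ?_ ?_ ?_ ?_ ?_ <;> simp <;> grind
    · exact hbad (killC4 hV ih hxU ha hb hc d1 d2 d3 d4 d5 d6 ⟨e1, Ne.symm hby, e2⟩ nx na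
        (l3.of_del1 d2.symm hby) nc)
  · obtain ⟨e1, e2, nx⟩ := l1.del1_left hxy
    by_cases hby : b = y
    · subst hby
      have nc := (l3.of_del1 d3.symm d4.symm).2
      rw [del1_comm] at l2
      obtain ⟨-, -, nb⟩ := l2.del1_left hyx
      apply hbad
      refine pickL hV ih [b] [x, b, c] [] [] ?_ ?_ ?_ ?_ ?_ ?_ ?_ ?_ ?_ <;> simp <;> grind
    by_cases hcy : c = y
    · subst hcy
      have nb := (l2.of_del1 d2.symm d4).2
      rw [del1_comm] at l3
      obtain ⟨-, -, nc⟩ := l3.del1_left hyx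
      apply hbad
      refine pickL hV ih [c] [x, b, c] [] [] ?_ ?_ ?_ ?_ ?_ ?_ ?_ ?_ ?_ <;> simp <;> grind
    have nb := l2.of_del1 d2.symm hby
    have nc := l3.of_del1 d3.symm hcy
    have hxm : G.Adj x m := (nx m).2 (by simp)
    have hmU : m ∉ U := fun h => dj m h hm
    have hnU : n ∉ U := fun h => dj n h hn
    have hcf : Conf G U M x m := by
      rcases edge_conf hV ih2 hbad hxm hx (fun h => absurd h hmU) with h | h
      · exact h
      · unfold Conf at h; grind
    have red : ∀ p q, N2 (del1 G x m) x p q → (p = n ∧ q = y) ∨ (p = y ∧ q = n) := by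
      intro p q h
      obtain ⟨f1, f2, f3⟩ := h.del1_left hxm
      have := h.1
      have := f3 p
      have := f3 q
      grind
    -- the case of a second triple between `n` and `y`
    have two : ∀ b' c', y ∈ M → b' ∈ U → c' ∈ U → x ≠ b' → x ≠ c' → b' ≠ c' → N2 G b' n c' →
        N2 G c' b' y → False := by
      intro b' c' hyM hb' hc' f1 f2 f3 nb' nc'
      have := nb.2
      have := nc.2
      have := nb'.2
      have := nc'.2
      have := nb.1
      have := nc.1
      have hyU : y ∉ U := fun h => dj y h hyM
      have hbn := (nb.2 n).2 (by simp)
      have hcm := (nc.2 m).2 (by simp)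
      have hcb := (nc.2 b).2 (by simp)
      have hbn' := (nb'.2 n).2 (by simp)
      have hcy' := (nc'.2 y).2 (by simp)
      have hcb' := (nc'.2 b').2 (by simp)
      have q1 : c ≠ c' := by
        rintro rfl
        have := (nc'.2 m).1 hcm
        grind
      have q2 : b ≠ c' := by
        rintro rfl
        have := (nc'.2 n).1 hbn
        grind
      have q3 : c ≠ b' := by
        rintro rfl
        have := (nc.2 n).1 hbn'
        grind
      have q4 : b ≠ b' := by
        rintro rfl
        have := (nb.2 c').1 hcb'.symm
        grind
      apply hbad
      refine pickL hV ih [m, n, y] [x, b, c, b', c'] [m, n, y] [] ?_ ?_ ?_ ?_ ?_ ?_ ?_ ?_ ?_ <;>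
        simp
      · grind
      · grind
      · grind
      · grind
      · rintro u hu ((rfl | rfl | rfl | rfl | rfl) | ⟨z, ((rfl | rfl | rfl | rfl | rfl) |
          (rfl | rfl | rfl)), hz⟩) <;> grind
    rcases hcf with ⟨a', b', c', -, ha', hb', hc', f1, f2, f3, f4, f5, f6, g1, g2, g3, g4⟩ |
      ⟨m', n', b', c', hm', hn', -, hb', hc', f1, f2, f3, f4, g1, g2, g3⟩ |
      ⟨m', n', a', c', hm', hn', ha', -, hc', f1, f2, f3, f4, g1, g2, g3⟩
    · have := red _ _ g1
      grind
    · have nb' := g2.of_del1 f2.symm (fun h => hmU (h ▸ hb'))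
      have nc' := g3.of_del1 f3.symm (fun h => hmU (h ▸ hc'))
      rcases red _ _ g1 with ⟨rfl, rfl⟩ | ⟨rfl, rfl⟩
      · exact two c' b' hn' hc' hb' f3 f2 f4.symm nc'.symm nb'.symm
      · exact two b' c' hm' hb' hc' f2 f3 f4 nb' nc'
    · have := red _ _ g2
      have hcy' : c' = y := by grind
      subst hcy'
      exact hy hc' _ _ (g3.of_del1 f4.symm (fun h => hmU (h ▸ hc')))
  · obtain ⟨e1, e2, nx⟩ := l2.del1_left hxy
    have nc := l3.of_del1 d4.symm e2.symm
    by_cases hay : a = y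
    · subst hay
      have nc := nc.2
      rw [del1_comm] at l1
      obtain ⟨-, -, na⟩ := l1.del1_left hyx
      apply hbad
      refine pickL hV ih [x] [x, a, c] [] [] ?_ ?_ ?_ ?_ ?_ ?_ ?_ ?_ ?_ <;> simp <;> grind
    have na := l1.of_del1 d2 hay
    by_cases hmy : y = m
    · subst hmy
      have := na.2
      have := nc.2
      apply hbad
      refine pickL hV ih [y] [x, a, c] [y] [] ?_ ?_ ?_ ?_ ?_ ?_ ?_ ?_ ?_ <;> simp <;> grind
    have hxn : G.Adj x n := (nx n).2 (by simp)
    have hmU : m ∉ U := fun h => dj m h hm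
    have hnU : n ∉ U := fun h => dj n h hn
    have hcf : Conf G U M x n := by
      rcases edge_conf hV ih2 hbad hxn hx (fun h => absurd h hnU) with h | h
      · exact h
      · unfold Conf at h; grind
    have red : ∀ p q, N2 (del1 G x n) x p q → (p = c ∧ q = y) ∨ (p = y ∧ q = c) := by
      intro p q h
      obtain ⟨f1, f2, f3⟩ := h.del1_left hxn
      have := h.1
      have := f3 p
      have := f3 q
      grind
    have hcn : c ≠ n := fun h => hnU (h ▸ hc)
    have redc : ∀ p q, N2 (del1 G x n) c p q → (p = x ∧ q = m) ∨ (p = m ∧ q = x) := by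
      intro p q h
      have h1 := (h.of_del1 d4.symm hcn)
      have := h1.1
      have := h1.2 p
      have := h1.2 q
      have := nc.2 p
      have := nc.2 q
      grind
    rcases hcf with ⟨a', b', c', -, ha', hb', hc', f1, f2, f3, f4, f5, f6, g1, g2, g3, g4⟩ |
      ⟨m', n', b', c', hm', hn', -, hb', hc', f1, f2, f3, f4, g1, g2, g3⟩ |
      ⟨m', n', a', c', hm', hn', ha', -, hc', f1, f2, f3, f4, g1, g2, g3⟩
    · rcases red _ _ g1 with ⟨rfl, rfl⟩ | ⟨rfl, rfl⟩
      · have := redc _ _ g2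
        grind
      · have := redc _ _ g4
        grind
    · have := red _ _ g1
      grind
    · rcases red _ _ g2 with ⟨rfl, rfl⟩ | ⟨rfl, rfl⟩
      · exact dj _ hc hn'
      · have hmm : m' = m := by
          have := redc _ _ g3
          grind
        subst hmm
        have na' := g1.of_del1 f2 (fun h => hnU (h ▸ ha'))
        have := na.2
        have := nc.2
        have := na'.2
        have haa : a ≠ a' := by
          rintro rfl
          have := (na.2 _).1 ((na'.2 _).2 (Or.inr rfl))
          grind
        apply hbad
        refine pickL hV ih [m', n] [x, a, a', c'] [m', n] [] ?_ ?_ ?_ ?_ ?_ ?_ ?_ ?_ ?_ <;>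
          simp <;> grind

theorem edge_two {G : SimpleGraph V} {U M : Finset V} (hV : Valid G U M) (ih : IH1 U M)
    (ih2 : IH2 G U M) (hbad : ¬ Good G U M) {x y : V} (hxy : G.Adj x y) :
    (x ∈ U ∧ ∃ p q, N2 G x p q) ∨ (y ∈ U ∧ ∃ p q, N2 G y p q) := by
  by_contra hcon
  have hx : x ∈ U → ∀ p q, ¬ N2 G x p q := fun h p q h' => hcon (Or.inl ⟨h, p, q, h'⟩)
  have hy : y ∈ U → ∀ p q, ¬ N2 G y p q := fun h p q h' => hcon (Or.inr ⟨h, p, q, h'⟩)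
  rcases edge_conf hV ih2 hbad hxy hx hy with h | h
  · exact hbad (kill_conf hV ih ih2 hxy hx hy h)
  · exact hbad (kill_conf hV ih ih2 hxy.symm hy hx h)

/-- There are no three consecutive unmarked vertices of degree two. -/
theorem no_three {G : SimpleGraph V} {U M : Finset V} (hV : Valid G U M) (ih : IH1 U M)
    (ih2 : IH2 G U M) (hbad : ¬ Good G U M) {a b c x y : V} (ha : a ∈ U) (hb : b ∈ U) (hc : c ∈ U)
    (na : N2 G a x b) (nb : N2 G b a c) (nc : N2 G c b y) : False := by
  have symm : ∀ p q, G.Adj p q → G.Adj q p := fun p q h => h.symm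
  have irr : ∀ p, ¬ G.Adj p p := fun p => G.irrefl
  have dj := hV.disj
  have hac := nb.1
  have hxb := na.1
  have hby := nc.1
  have Ax : G.Adj a x := (na.2 x).2 (Or.inl rfl)
  have Ab : G.Adj a b := (na.2 b).2 (Or.inr rfl)
  have Bc : G.Adj b c := (nb.2 c).2 (Or.inr rfl)
  have Cy : G.Adj c y := (nc.2 y).2 (Or.inr rfl)
  have hax := Ax.ne
  have hab := Ab.ne
  have hbc := Bc.ne
  have hcy := Cy.ne
  have na2 := na.2
  have nb2 := nb.2
  have nc2 := nc.2
  apply hbad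
  by_cases hxc : x = c
  · subst hxc
    have : y = a := by
      have := (nc.2 a).1 Ax.symm
      grind
    subst this
    refine pickL hV ih [b] [y, b, x] [] [] ?_ ?_ ?_ ?_ ?_ ?_ ?_ ?_ ?_ <;> simp <;> grind
  have hya : y ≠ a := by
    rintro rfl
    have := (na.2 c).1 Cy.symm
    grind
  by_cases hxy : x = y
  · subst hxy
    rcases hV.mem x a Ax.symm with hxU | hxM
    · by_cases hp : ∃ p, p ≠ a ∧ p ≠ c ∧ G.Adj x p
      · obtain ⟨p, hpa, hpc, hp⟩ := hp
        by_cases hq : ∃ q, q ≠ p ∧ q ≠ a ∧ q ≠ c ∧ G.Adj x q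
        · obtain ⟨q, hqp, hqa, hqc, hq⟩ := hq
          exact contract hV ih ha hb hc na nb nc hxc hya
            (Or.inr ⟨rfl, fun _ => ⟨p, q, hqp.symm, hpa, hpc, hqa, hqc, hp, hq⟩⟩)
        · have hpb : p ≠ b := by
            rintro rfl
            have := (nb.2 x).1 hp.symm
            grind
          refine killC4 hV ih hxU ha hb hc hax.symm hxb (Ne.symm hcy) hab hac hbc ⟨hpa, hpb, hpc⟩
            (fun z => ?_) na nb nc
          grind
      · have nx : N2 G x c a := by
          refine ⟨hac.symm, fun z => ?_⟩
          grind
        have hE : Exc G U M {x, a, b, c} := Or.inl ⟨x, a, b, c, rfl, hxU, ha, hb, hc, hax.symm, hxb,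
          hcy.symm, hab, hac, hbc, nx, na, nb, nc⟩
        have hcard : ({x, a, b, c} : Finset V).card = 4 := by
          rw [card_insert_of_notMem, card_insert_of_notMem, card_insert_of_notMem,
            card_singleton] <;> simp only [mem_insert, mem_singleton] <;> grind
        have nx2 := nx.2
        refine pick hV ih {x, b} {x, a, b, c} ∅ ∅ {{x, a, b, c}} ?_ ?_ ?_ ?_ ?_ ?_ ?_ ?_
        · intro v; simp; grind
        · simp
        · exact ⟨x, by simp⟩
        · simp; grind
        · simp
        · simpa using hE
        · simp
        · rw [sum_singleton, pen, if_pos hcard, hcard, card_pair hxb]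
          simp
    · refine pickL hV ih [b] [a, b, c] [] [] ?_ ?_ ?_ ?_ ?_ ?_ ?_ ?_ ?_ <;> simp <;> grind
  by_cases hadj : G.Adj x y
  · have Ya := hadj.symm
    rcases edge_two hV ih ih2 hbad hadj with ⟨hxU, p, q, nx⟩ | ⟨hyU, p, q, ny⟩
    · have nx' : ∀ z, G.Adj x z ↔ z = a ∨ z = y := by
        have := nx.2
        have := nx.1
        have := (nx.2 a).1 Ax.symm
        have := (nx.2 y).1 hadj
        grind
      rcases hV.mem y x hadj.symm with hyU | hyM
      · refine pickL hV ih [y, b] [x, a, b, c, y] [] [] ?_ ?_ ?_ ?_ ?_ ?_ ?_ ?_ ?_ <;> simp <;> grind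
      · refine pickL hV ih [y, b] [x, a, b, c] [y] [] ?_ ?_ ?_ ?_ ?_ ?_ ?_ ?_ ?_ <;> simp <;> grind
    · have ny' : ∀ z, G.Adj y z ↔ z = c ∨ z = x := by
        have := ny.2
        have := ny.1
        have := (ny.2 c).1 Cy.symm
        have := (ny.2 x).1 hadj.symm
        grind
      rcases hV.mem x y hadj with hxU | hxM
      · refine pickL hV ih [x, b] [x, a, b, c, y] [] [] ?_ ?_ ?_ ?_ ?_ ?_ ?_ ?_ ?_ <;> simp <;> grind
      · refine pickL hV ih [x, b] [y, a, b, c] [x] [] ?_ ?_ ?_ ?_ ?_ ?_ ?_ ?_ ?_ <;> simp <;> grind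
  · exact contract hV ih ha hb hc na nb nc hxc hya (Or.inl ⟨hxy, hadj⟩)

/-- no triangle with two unmarked vertices of degree two -/
theorem no_tri {G : SimpleGraph V} {U M : Finset V} (hV : Valid G U M) (ih : IH1 U M)
    (hbad : ¬ Good G U M) {u v z : V} (hu : u ∈ U) (hv : v ∈ U)
    (nu : N2 G u z v) (nv : N2 G v u z) : False := by
  have symm : ∀ p q, G.Adj p q → G.Adj q p := fun p q h => h.symm
  have dj := hV.disj
  have h1 := nu.1
  have h2 := nv.1
  have Uv : G.Adj u v := (nu.2 v).2 (Or.inr rfl)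
  have Uz : G.Adj u z := (nu.2 z).2 (Or.inl rfl)
  have huv := Uv.ne
  have nu := nu.2
  have nv := nv.2
  apply hbad
  rcases hV.mem z u Uz.symm with hz | hz
  · refine pickL hV ih [z] [z, u, v] [] [] ?_ ?_ ?_ ?_ ?_ ?_ ?_ ?_ ?_ <;> simp <;> grind
  · refine pickL hV ih [z] [u, v] [z] [] ?_ ?_ ?_ ?_ ?_ ?_ ?_ ?_ ?_ <;> simp <;> grind

def Big (G : SimpleGraph V) (U : Finset V) (b : V) : Prop := b ∈ U ∧ ∀ p q, ¬ N2 G b p q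

theorem nb_two {G : SimpleGraph V} {U M : Finset V} (hV : Valid G U M) (ih : IH1 U M)
    (ih2 : IH2 G U M) (hbad : ¬ Good G U M) {b z : V} (h : Big G U b ∨ b ∈ M) (hz : G.Adj b z) :
    z ∈ U ∧ ∃ s, N2 G z b s := by
  rcases edge_two hV ih ih2 hbad hz with ⟨h1, p, q, h2⟩ | ⟨h1, p, q, h2⟩
  · rcases h with h | h
    · exact absurd h2 (h.2 p q)
    · exact (hV.disj b h1 h).elim
  · refine ⟨h1, ?_⟩
    rcases (h2.2 b).1 hz.symm with rfl | rfl
    · exact ⟨q, h2⟩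
    · exact ⟨p, h2.symm⟩

theorem big3 {G : SimpleGraph V} {U M : Finset V} (hV : Valid G U M) {b u : V} (h : Big G U b)
    (hu : G.Adj b u) : ∃ p q, p ≠ q ∧ p ≠ u ∧ q ≠ u ∧ G.Adj b p ∧ G.Adj b q := by
  obtain ⟨p, q, h1, h2, h3⟩ := hV.deg b h.1
  by_contra hcon
  have key : ∃ p, p ≠ u ∧ G.Adj b p := by
    by_cases h : p = u
    · exact ⟨q, by grind, h3⟩
    · exact ⟨p, h, h2⟩
  obtain ⟨p, hp, hbp⟩ := key
  apply h.2 u p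
  refine ⟨hp.symm, fun z => ?_⟩
  grind

theorem big_alpha {G : SimpleGraph V} {U M : Finset V} (hV : Valid G U M) (ih : IH1 U M)
    (ih2 : IH2 G U M) (hbad : ¬ Good G U M) {b u m : V} (hb : Big G U b) (hu : u ∈ U) (hm : m ∈ M)
    (nu : N2 G u b m) : False := by
  have symm : ∀ p q, G.Adj p q → G.Adj q p := fun p q h => h.symm
  have dj := hV.disj
  have Ub : G.Adj u b := (nu.2 b).2 (Or.inl rfl)
  have hub := Ub.ne
  obtain ⟨p, q, h1, h2, h3, h4, h5⟩ := big3 hV hb Ub.symm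
  obtain ⟨hp, s, np⟩ := nb_two hV ih ih2 hbad (Or.inl hb) h4
  obtain ⟨hq, t, nq⟩ := nb_two hV ih ih2 hbad (Or.inl hb) h5
  have hbU := hb.1
  have h4' := h4.ne
  have h5' := h5.ne
  have nu := nu.2
  apply hbad
  refine pickL hV ih [b] [b, u] [] [p, q] ?_ ?_ ?_ ?_ ?_ ?_ ?_ ?_ ?_ <;> simp <;> grind

theorem big_beta {G : SimpleGraph V} {U M : Finset V} (hV : Valid G U M) (ih : IH1 U M)
    (ih2 : IH2 G U M) (hbad : ¬ Good G U M) {b b' u v : V} (hb : Big G U b) (hb' : Big G U b')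
    (hne : b ≠ b') (hu : u ∈ U) (hv : v ∈ U) (nu : N2 G u b v) (nv : N2 G v u b') : False := by
  have symm : ∀ p q, G.Adj p q → G.Adj q p := fun p q h => h.symm
  have dj := hV.disj
  have Ub : G.Adj u b := (nu.2 b).2 (Or.inl rfl)
  have Uv : G.Adj u v := (nu.2 v).2 (Or.inr rfl)
  have Vb : G.Adj v b' := (nv.2 b').2 (Or.inr rfl)
  have hub := Ub.ne
  have huv := Uv.ne
  have hvb := Vb.ne
  have k1 := nu.1
  have k2 := nv.1
  obtain ⟨p, q, h1, h2, h3, h4, h5⟩ := big3 hV hb Ub.symm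
  obtain ⟨hp, s, np⟩ := nb_two hV ih ih2 hbad (Or.inl hb) h4
  obtain ⟨hq, t, nq⟩ := nb_two hV ih ih2 hbad (Or.inl hb) h5
  have hpb : p ≠ b' := by rintro rfl; exact hb'.2 _ _ np
  have hqb : q ≠ b' := by rintro rfl; exact hb'.2 _ _ nq
  have hvb' : ¬ G.Adj b v := by
    intro h
    have := (nv.2 b).1 h.symm
    grind
  have hbU := hb.1
  have hbU' := hb'.1
  have h4' := h4.ne
  have h5' := h5.ne
  have nu := nu.2
  have nv := nv.2
  apply hbad
  refine pickL hV ih [b, b'] [b, b', u, v] [] [p, q] ?_ ?_ ?_ ?_ ?_ ?_ ?_ ?_ ?_ <;> simp <;> grind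

theorem big_gamma {G : SimpleGraph V} {U M : Finset V} (hV : Valid G U M) (ih : IH1 U M)
    (ih2 : IH2 G U M) (hbad : ¬ Good G U M) {b m u v : V} (hb : Big G U b) (hm : m ∈ M)
    (hu : u ∈ U) (hv : v ∈ U) (nu : N2 G u b v) (nv : N2 G v u m) : False := by
  have symm : ∀ p q, G.Adj p q → G.Adj q p := fun p q h => h.symm
  have dj := hV.disj
  have Ub : G.Adj u b := (nu.2 b).2 (Or.inl rfl)
  have Uv : G.Adj u v := (nu.2 v).2 (Or.inr rfl)
  have Vm : G.Adj v m := (nv.2 m).2 (Or.inr rfl)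
  have hub := Ub.ne
  have huv := Uv.ne
  have hvb := Vm.ne
  have k1 := nu.1
  have k2 := nv.1
  have hbU := hb.1
  have hbm : b ≠ m := fun h => dj b hbU (h ▸ hm)
  by_cases hs : ∃ s, s ≠ v ∧ G.Adj m s
  · obtain ⟨s, hsv, hms⟩ := hs
    obtain ⟨hsU, w, ns⟩ := nb_two hV ih ih2 hbad (Or.inr hm) hms
    obtain ⟨p, q, h1, h2, h3, h4, h5⟩ := big3 hV hb Ub.symm
    obtain ⟨hp, p', np⟩ := nb_two hV ih ih2 hbad (Or.inl hb) h4
    obtain ⟨hq, q', nq⟩ := nb_two hV ih ih2 hbad (Or.inl hb) h5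
    have hbv : ¬ G.Adj b v := by
      intro h
      have := (nv.2 b).1 h.symm
      grind
    have hal : ∀ z z', z ∈ U → N2 G z b z' → z ≠ s := by
      rintro z z' hz nz rfl
      have := (nz.2 m).1 hms.symm
      rcases this with h | rfl
      · exact hbm h.symm
      · exact big_alpha hV ih ih2 hbad hb hz hm nz
    have hps := hal p p' hp np
    have hqs := hal q q' hq nq
    have hsb : s ≠ b := by rintro rfl; exact hb.2 _ _ ns
    have hsu : s ≠ u := by
      rintro rfl
      have := (nu.2 m).1 hms.symm
      grind
    have h4' := h4.ne
    have h5' := h5.ne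
    have nu := nu.2
    have nv := nv.2
    apply hbad
    refine pickL hV ih [b, m] [b, u, v] [m] [p, q, s] ?_ ?_ ?_ ?_ ?_ ?_ ?_ ?_ ?_ <;> simp <;> grind
  · have nu := nu.2
    have nv := nv.2
    apply hbad
    refine pickL hV ih [u] [u, v] [m] [] ?_ ?_ ?_ ?_ ?_ ?_ ?_ ?_ ?_ <;> simp <;> grind

theorem big_nb {G : SimpleGraph V} {U M : Finset V} (hV : Valid G U M) (ih : IH1 U M)
    (ih2 : IH2 G U M) (hbad : ¬ Good G U M) {b z : V} (hb : Big G U b) (hz : G.Adj b z) :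
    z ∈ U ∧ ∃ s, N2 G z b s ∧ Big G U s := by
  obtain ⟨hzU, s, nz⟩ := nb_two hV ih ih2 hbad (Or.inl hb) hz
  refine ⟨hzU, s, nz, ?_⟩
  have Zs : G.Adj z s := (nz.2 s).2 (Or.inr rfl)
  rcases hV.mem s z Zs.symm with hs | hs
  · refine ⟨hs, fun p q hpq => ?_⟩
    obtain ⟨w, nw⟩ : ∃ w, N2 G s z w := by
      rcases (hpq.2 z).1 Zs.symm with rfl | rfl
      · exact ⟨_, hpq⟩
      · exact ⟨_, hpq.symm⟩
    have Sw : G.Adj s w := (nw.2 w).2 (Or.inr rfl)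
    rcases hV.mem w s Sw.symm with hw | hw
    · by_cases hW : Big G U w
      · by_cases hbw : b = w
        · subst hbw
          exact no_tri hV ih hbad hzU hs nz nw
        · exact big_beta hV ih ih2 hbad hb hW hbw hzU hs nz nw
      · obtain ⟨p, q, h⟩ : ∃ p q, N2 G w p q := by
          by_contra hcon
          exact hW ⟨hw, fun p q h => hcon ⟨p, q, h⟩⟩
        rcases (h.2 s).1 Sw.symm with rfl | rfl
        · exact no_three hV ih ih2 hbad hzU hs hw nz nw h
        · exact no_three hV ih ih2 hbad hzU hs hw nz nw h.symm
    · exact big_gamma hV ih ih2 hbad hb hw hzU hs nz nw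
  · exact (big_alpha hV ih ih2 hbad hb hzU hs nz).elim

theorem no_big {G : SimpleGraph V} {U M : Finset V} (hV : Valid G U M) (ih : IH1 U M)
    (ih2 : IH2 G U M) (hbad : ¬ Good G U M) (b : V) : ¬ Big G U b := by
  classical
  intro hb
  set B := U.filter (fun b => Big G U b) with hB
  have memB : ∀ v, v ∈ B ↔ Big G U v := by
    intro v; simp only [hB, mem_filter]; exact ⟨fun h => h.2, fun h => ⟨h.1, h⟩⟩
  set N := U.filter (fun z => ∃ b ∈ B, G.Adj b z) with hN
  have memN : ∀ v, v ∈ N ↔ ∃ b, Big G U b ∧ G.Adj b v := by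
    intro v; simp only [hN, mem_filter, memB]
    exact ⟨fun h => h.2, fun h => ⟨by
      obtain ⟨b, h1, h2⟩ := h; exact (big_nb hV ih ih2 hbad h1 h2).1, h⟩⟩
  have hdis : Disjoint B N := by
    rw [Finset.disjoint_left]
    intro v h1 h2
    rw [memB] at h1
    rw [memN] at h2
    obtain ⟨b, h3, h4⟩ := h2
    obtain ⟨-, s, h5, -⟩ := big_nb hV ih ih2 hbad h3 h4
    exact h1.2 _ _ h5
  have hcount : B.card * 3 ≤ N.card * 2 := by
    apply card_mul_le_card_mul (fun a b => G.Adj a b)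
    · intro a ha
      rw [memB] at ha
      obtain ⟨u, -, -, hu, -⟩ := hV.deg a ha.1
      obtain ⟨p, q, h1, h2, h3, h4, h5⟩ := big3 hV ha hu
      have : ({u, p, q} : Finset V).card = 3 := by
        rw [card_insert_of_notMem, card_insert_of_notMem, card_singleton] <;>
          simp only [mem_insert, mem_singleton] <;> grind
      rw [← this]
      apply card_le_card
      intro z hz
      simp only [mem_insert, mem_singleton] at hz
      rw [mem_bipartiteAbove, memN]
      have : G.Adj a z := by rcases hz with rfl | rfl | rfl <;> assumption
      exact ⟨⟨a, ha, this⟩, this⟩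
    · intro z hz
      rw [memN] at hz
      obtain ⟨b, h3, h4⟩ := hz
      obtain ⟨-, s, h5, -⟩ := big_nb hV ih ih2 hbad h3 h4
      refine (card_le_card (t := {b, s}) ?_).trans card_le_two
      intro w hw
      rw [mem_bipartiteBelow] at hw
      have := (h5.2 w).1 hw.2.symm
      simpa using this
  apply hbad
  refine pick hV ih B (B ∪ N) ∅ ∅ ∅ ?_ ?_ ?_ ?_ ?_ ?_ ?_ ?_
  · intro v hv
    rcases mem_union.1 hv with h | h
    · exact ((memB v).1 h).1
    · exact (mem_filter.1 h).1
  · simp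
  · exact ⟨b, by simp [(memB b).2 hb]⟩
  · have main : ∀ y ∈ N, ∀ u, G.Adj y u → u ∈ B := by
      intro y hy u hu
      rw [memN] at hy
      obtain ⟨b, h3, h4⟩ := hy
      obtain ⟨-, s, h5, h6⟩ := big_nb hV ih ih2 hbad h3 h4
      rw [memB]
      rcases (h5.2 u).1 hu with rfl | rfl
      · exact h3
      · exact h6
    rintro u hu (h | ⟨y, h | h, hyu⟩)
    · rcases mem_union.1 h with h | h
      · exact Or.inl h
      · obtain ⟨b, h3, h4⟩ := (memN u).1 h
        exact Or.inr ⟨b, (memB b).2 h3, h4⟩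
    · rcases mem_union.1 h with h | h
      · exact Or.inr ⟨y, h, hyu⟩
      · exact Or.inl (main y h u hyu)
    · simp at h
  · simp
  · simp
  · simp
  · rw [card_union_of_disjoint hdis]
    simp
    omega

theorem all_two {G : SimpleGraph V} {U M : Finset V} (hV : Valid G U M) (ih : IH1 U M)
    (ih2 : IH2 G U M) (hbad : ¬ Good G U M) {v s : V} (hv : v ∈ U) (h : G.Adj v s) :
    ∃ t, N2 G v s t := by
  obtain ⟨p, q, hpq⟩ : ∃ p q, N2 G v p q := by
    by_contra hcon
    exact no_big hV ih ih2 hbad v ⟨hv, fun p q h => hcon ⟨p, q, h⟩⟩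
  rcases (hpq.2 s).1 h with rfl | rfl
  · exact ⟨_, hpq⟩
  · exact ⟨_, hpq.symm⟩

theorem no_delta {G : SimpleGraph V} {U M : Finset V} (hV : Valid G U M) (ih : IH1 U M)
    (ih2 : IH2 G U M) (hbad : ¬ Good G U M) {u m m' : V} (hu : u ∈ U) (hm : m ∈ M) (hm' : m' ∈ M)
    (nu : N2 G u m m') : False := by
  have symm : ∀ p q, G.Adj p q → G.Adj q p := fun p q h => h.symm
  have dj := hV.disj
  have Um : G.Adj u m := (nu.2 m).2 (Or.inl rfl)
  have Um' : G.Adj u m' := (nu.2 m').2 (Or.inr rfl)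
  have k1 := nu.1
  have nu2 := nu.2
  by_cases hs : ∃ s, s ≠ u ∧ G.Adj m s
  swap
  · apply hbad
    refine pickL hV ih [m'] [u] [m, m'] [] ?_ ?_ ?_ ?_ ?_ ?_ ?_ ?_ ?_ <;> simp <;> grind
  obtain ⟨s, hsu, hms⟩ := hs
  obtain ⟨hsU, t, ns⟩ := nb_two hV ih ih2 hbad (Or.inr hm) hms
  have ns2 := ns.2
  have St : G.Adj s t := (ns.2 t).2 (Or.inr rfl)
  have k2 := ns.1
  have k3 := St.ne
  rcases hV.mem t s St.symm with ht | ht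
  swap
  · apply hbad
    refine pickL hV ih [m] [u, s] [m] [] ?_ ?_ ?_ ?_ ?_ ?_ ?_ ?_ ?_ <;> simp <;> grind
  obtain ⟨n, nt⟩ := all_two hV ih ih2 hbad ht St.symm
  have Tn : G.Adj t n := (nt.2 n).2 (Or.inr rfl)
  have nt2 := nt.2
  have k4 := nt.1
  have k5 := Tn.ne
  rcases hV.mem n t Tn.symm with hn | hn
  · obtain ⟨y, ny⟩ := all_two hV ih ih2 hbad hn Tn.symm
    exact no_three hV ih ih2 hbad hsU ht hn ns nt ny
  by_cases hnm : n = m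
  · subst hnm
    exact no_tri hV ih hbad hsU ht ns nt
  have htu : t ≠ u := by
    rintro rfl
    have := (nu.2 s).1 St.symm
    grind
  by_cases hnm' : n = m'
  · subst hnm'
    have hE : Exc5 G U M {m, n, u, t, s} := ⟨m, n, u, t, s, rfl, hm, hm', hu, ht, hsU, k1, htu.symm,
      hsu.symm, k3.symm, nu, nt.symm, ns.symm⟩
    have hp := hE.pen_le hV
    have hc : ({u, t, s} : Finset V).card = 3 := by
      rw [card_insert_of_notMem, card_insert_of_notMem, card_singleton] <;>
        simp only [mem_insert, mem_singleton] <;> grind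
    apply hbad
    refine pick hV ih {m, n} {u, t, s} {m, n} ∅ {{m, n, u, t, s}} ?_ ?_ ?_ ?_ ?_ ?_ ?_ ?_
    · intro v; simp; grind
    · intro v; simp; grind
    · exact ⟨u, by simp⟩
    · simp; grind
    · simp
    · intro S hS
      rw [mem_singleton] at hS
      subst hS
      refine ⟨Or.inr hE, fun v => ?_⟩
      simp; grind
    · simp
    · rw [sum_singleton, hp, hc, card_pair k1]
      simp
  by_cases hx : ∃ x, x ≠ t ∧ G.Adj n x
  · obtain ⟨x, hxt, hnx⟩ := hx
    obtain ⟨hxU, w, nx⟩ := nb_two hV ih ih2 hbad (Or.inr hn) hnx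
    have hxs : x ≠ s := by
      rintro rfl
      have := (ns.2 n).1 hnx.symm
      grind
    have hxu : x ≠ u := by
      rintro rfl
      have := (nu.2 n).1 hnx.symm
      grind
    apply hbad
    refine pickL hV ih [m, n] [s, t, u] [m, n] [x] ?_ ?_ ?_ ?_ ?_ ?_ ?_ ?_ ?_ <;> simp <;> grind
  · apply hbad
    refine pickL hV ih [s] [s, t] [n] [] ?_ ?_ ?_ ?_ ?_ ?_ ?_ ?_ ?_ <;> simp <;> grind

theorem struct {G : SimpleGraph V} {U M : Finset V} (hV : Valid G U M) (ih : IH1 U M)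
    (ih2 : IH2 G U M) (hbad : ¬ Good G U M) {u : V} (hu : u ∈ U) :
    ∃ m v n, m ∈ M ∧ v ∈ U ∧ n ∈ M ∧ N2 G u m v ∧ N2 G v u n := by
  have aux : ∀ v, v ∈ U → ∀ m, N2 G u m v → m ∈ M →
      ∃ m v n, m ∈ M ∧ v ∈ U ∧ n ∈ M ∧ N2 G u m v ∧ N2 G v u n := by
    intro v hv m nu hm
    have Uv : G.Adj u v := (nu.2 v).2 (Or.inr rfl)
    obtain ⟨w, nv⟩ := all_two hV ih ih2 hbad hv Uv.symm
    have Vw : G.Adj v w := (nv.2 w).2 (Or.inr rfl)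
    rcases hV.mem w v Vw.symm with hw | hw
    · obtain ⟨y, nw⟩ := all_two hV ih ih2 hbad hw Vw.symm
      exact (no_three hV ih ih2 hbad hu hv hw nu nv nw).elim
    · exact ⟨m, v, w, hm, hv, hw, nu, nv⟩
  obtain ⟨p, -, -, hp, -⟩ := hV.deg u hu
  obtain ⟨q, nu⟩ := all_two hV ih ih2 hbad hu hp
  have hq : G.Adj u q := (nu.2 q).2 (Or.inr rfl)
  rcases hV.mem p u hp.symm with hpU | hpM <;> rcases hV.mem q u hq.symm with hqU | hqM
  · obtain ⟨x, nx⟩ := all_two hV ih ih2 hbad hpU hp.symm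
    obtain ⟨y, ny⟩ := all_two hV ih ih2 hbad hqU hq.symm
    exact (no_three hV ih ih2 hbad hpU hu hqU nx.symm nu ny).elim
  · exact aux p hpU q nu.symm hqM
  · exact aux q hqU p nu hpM
  · exact (no_delta hV ih ih2 hbad hu hpM hqM nu).elim

theorem step {G : SimpleGraph V} {U M : Finset V} (hV : Valid G U M) (ih : IH1 U M)
    (ih2 : IH2 G U M) : Good G U M := by
  classical
  by_contra hbad
  have symm : ∀ p q, G.Adj p q → G.Adj q p := fun p q h => h.symm
  have dj := hV.disj
  have hm2 : ∀ m ∈ M, ∃ a b, a ≠ b ∧ G.Adj m a ∧ G.Adj m b := by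
    intro m hm
    by_contra hcon
    apply hbad
    by_cases h : ∃ u, G.Adj m u
    · obtain ⟨u, hmu⟩ := h
      obtain ⟨hu, -⟩ := nb_two hV ih ih2 hbad (Or.inr hm) hmu
      obtain ⟨m', v, n, hm', hv, hn, nu, nv⟩ := struct hV ih ih2 hbad hu
      have : m' = m := by
        have := (nu.2 m).1 hmu.symm
        grind
      subst this
      have := nu.2
      have := nv.2
      have huv : G.Adj u v := (nu.2 v).2 (Or.inr rfl)
      have := huv.ne
      refine pickL hV ih [u] [u, v] [m'] [] ?_ ?_ ?_ ?_ ?_ ?_ ?_ ?_ ?_ <;> simp <;> grind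
    · refine pickL hV ih [] [] [m] [] ?_ ?_ ?_ ?_ ?_ ?_ ?_ ?_ ?_ <;> simp <;> grind
  by_cases hne : (U ∪ M).Nonempty
  swap
  · rw [not_nonempty_iff_eq_empty, union_eq_empty] at hne
    apply hbad
    refine ⟨∅, ∅, ?_, ?_, ?_, ?_⟩ <;> simp [hne.1]
  have hcount : M.card * 2 ≤ U.card * 1 := by
    apply card_mul_le_card_mul (fun a b => G.Adj a b)
    · intro m hm
      obtain ⟨a, b, h1, h2, h3⟩ := hm2 m hm
      rw [← card_pair h1]
      apply card_le_card
      intro z hz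
      simp only [mem_insert, mem_singleton] at hz
      rw [mem_bipartiteAbove]
      have : G.Adj m z := by rcases hz with rfl | rfl <;> assumption
      exact ⟨(nb_two hV ih ih2 hbad (Or.inr hm) this).1, this⟩
    · intro u hu
      obtain ⟨m', v, n, hm', hv, hn, nu, nv⟩ := struct hV ih ih2 hbad hu
      rw [card_le_one]
      have key : ∀ a ∈ bipartiteBelow (fun a b => G.Adj a b) M u, a = m' := by
        intro a ha
        rw [mem_bipartiteBelow] at ha
        have := (nu.2 a).1 ha.2.symm
        grind
      intro a ha b hb
      rw [key a ha, key b hb]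
  apply hbad
  refine pick hV ih M U M ∅ ∅ (subset_refl _) (subset_refl _) hne ?_ ?_ ?_ ?_ ?_
  · intro u hu _
    obtain ⟨m', v, n, hm', hv, hn, nu, nv⟩ := struct hV ih ih2 hbad hu
    exact Or.inr ⟨m', hm', ((nu.2 m').2 (Or.inl rfl)).symm⟩
  · simp
  · simp
  · simp
  · simp
    omega

theorem good_all [Finite V] (n : ℕ) : ∀ (G : SimpleGraph V) (U M : Finset V), Valid G U M →
    U.card + M.card = n → Good G U M := by
  induction n using Nat.strong_induction_on with
  | _ n ih =>
    intro G
    induction G using WellFoundedLT.induction with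
    | _ G ih2 =>
      intro U M hV hn
      refine step hV ?_ ?_
      · intro G' U' M' hV' hlt
        exact ih _ (hn ▸ hlt) G' U' M' hV' rfl
      · intro G' hV' hlt
        exact ih2 G' hlt U M hV' hn

end NB

open Finset NB in
/-- Every `n`-vertex graph with no isolated vertices, in which every pair of distinct
degree-1 vertices is at distance at least 5 (no walk of length at most 4 joins them)
and no two degree-2 vertices are adjacent, has a dominating set of size at most `3/7 · n`. -/
theorem nonblocker_three_sevenths {V : Type*} [Fintype V] [DecidableEq V]
    (G : SimpleGraph V) [DecidableRel G.Adj]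
    (h1 : ∀ v : V, 1 ≤ G.degree v)
    (h2 : ∀ u v : V, u ≠ v → G.degree u = 1 → G.degree v = 1 →
      ∀ p : G.Walk u v, 5 ≤ p.length)
    (h3 : ∀ u v : V, G.degree u = 2 → G.degree v = 2 → ¬ G.Adj u v) :
    ∃ D : Finset V, (∀ v : V, v ∈ D ∨ ∃ u ∈ D, G.Adj u v) ∧
      (D.card : ℚ) ≤ 3 / 7 * (Fintype.card V : ℚ) := by
  classical
  set L : Finset V := univ.filter (fun v => G.degree v = 1) with hL
  set S : Finset V := univ.filter (fun v => ∃ l ∈ L, G.Adj v l) with hS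
  set U : Finset V := univ.filter (fun v => v ∉ S ∧ v ∉ L ∧ ¬ ∃ s ∈ S, G.Adj s v) with hU
  set M : Finset V := univ.filter (fun v => v ∉ S ∧ v ∉ L ∧ ∃ s ∈ S, G.Adj s v) with hM
  have memL : ∀ v, v ∈ L ↔ G.degree v = 1 := by simp [hL]
  have memS : ∀ v, v ∈ S ↔ ∃ l ∈ L, G.Adj v l := by simp [hS]
  have memU : ∀ v, v ∈ U ↔ v ∉ S ∧ v ∉ L ∧ ¬ ∃ s ∈ S, G.Adj s v := fun v => by
    rw [hU, mem_filter]; simp only [mem_univ, true_and]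
  have memM : ∀ v, v ∈ M ↔ v ∉ S ∧ v ∉ L ∧ ∃ s ∈ S, G.Adj s v := fun v => by
    rw [hM, mem_filter]; simp only [mem_univ, true_and]
  have uniq : ∀ l ∈ L, ∀ a b, G.Adj l a → G.Adj l b → a = b := by
    intro l hl a b ha hb
    have := (memL l).1 hl
    rw [← G.card_neighborFinset_eq_degree] at this
    exact card_le_one.1 this.le a (by simpa using ha) b (by simpa using hb)
  have two : ∀ v, v ∉ L → ∃ a b, a ≠ b ∧ G.Adj v a ∧ G.Adj v b := by
    intro v hv
    have h : 1 < G.degree v := by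
      have := h1 v
      rw [memL] at hv
      omega
    rw [← G.card_neighborFinset_eq_degree] at h
    obtain ⟨a, ha, b, hb, hab⟩ := one_lt_card.1 h
    exact ⟨a, b, hab, by simpa using ha, by simpa using hb⟩
  have far : ∀ l ∈ L, ∀ l' ∈ L, ∀ p : G.Walk l l', p.length ≤ 4 → l = l' := by
    intro l hl l' hl' p hp
    by_contra hne
    have := h2 l l' hne ((memL l).1 hl) ((memL l').1 hl') p
    omega
  have SL : Disjoint S L := by
    rw [Finset.disjoint_left]
    intro s hs hl
    obtain ⟨l, h, hsl⟩ := (memS s).1 hs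
    exact hsl.ne (far s hl l h (SimpleGraph.Walk.cons hsl SimpleGraph.Walk.nil) (by simp))
  have cSL : S.card ≤ L.card := by
    apply card_le_card_of_forall_subsingleton (fun s l => G.Adj s l)
    · intro s hs; exact (memS s).1 hs
    · intro l hl s hs s' hs'
      exact uniq l hl s s' hs.2.symm hs'.2.symm
  have cSM : S.card ≤ M.card := by
    apply card_le_card_of_forall_subsingleton (fun s t => G.Adj s t)
    · intro s hs
      obtain ⟨l, hl, hsl⟩ := (memS s).1 hs
      obtain ⟨a, b, hab, ha, hb⟩ := two s (Finset.disjoint_left.1 SL hs)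
      obtain ⟨t, htl, hst⟩ : ∃ t, t ≠ l ∧ G.Adj s t := by
        by_cases h : a = l
        · exact ⟨b, fun h' => hab (h.trans h'.symm), hb⟩
        · exact ⟨a, h, ha⟩
      refine ⟨t, (memM t).2 ⟨?_, ?_, s, hs, hst⟩, hst⟩
      · intro ht
        obtain ⟨l', hl', htl'⟩ := (memS t).1 ht
        have := far l hl l' hl' (SimpleGraph.Walk.cons hsl.symm (SimpleGraph.Walk.cons hst
          (SimpleGraph.Walk.cons htl' SimpleGraph.Walk.nil))) (by simp)
        subst this
        exact hst.ne (uniq l hl s t hsl.symm htl'.symm)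
      · intro ht
        exact htl (far l hl t ht (SimpleGraph.Walk.cons hsl.symm (SimpleGraph.Walk.cons hst
          SimpleGraph.Walk.nil)) (by simp)).symm
    · rintro t ht s ⟨hs, hst⟩ s' ⟨hs', hst'⟩
      obtain ⟨l, hl, hsl⟩ := (memS s).1 hs
      obtain ⟨l', hl', hsl'⟩ := (memS s').1 hs'
      have := far l hl l' hl' (SimpleGraph.Walk.cons hsl.symm (SimpleGraph.Walk.cons hst
          (SimpleGraph.Walk.cons hst'.symm (SimpleGraph.Walk.cons hsl' SimpleGraph.Walk.nil))))
          (by simp)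
      subst this
      exact uniq l hl s s' hsl.symm hsl'.symm
  have total : U.card + M.card + S.card + L.card = Fintype.card V := by
    have d1 : Disjoint U M := by
      rw [Finset.disjoint_left]; intro v; rw [memU, memM]; exact fun a b => a.2.2 b.2.2
    have d2 : Disjoint (U ∪ M) (S ∪ L) := by
      rw [Finset.disjoint_left]; intro v; rw [mem_union, mem_union, memU, memM]; tauto
    have e : (U ∪ M) ∪ (S ∪ L) = univ := by
      ext v; simp only [mem_union, memU, memM, mem_univ, iff_true]; tauto
    rw [← card_univ, ← e, card_union_of_disjoint d2, card_union_of_disjoint d1,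
      card_union_of_disjoint SL]
    omega
  have keep : ∀ u ∈ U, ∀ z, (del G (S ∪ L)).Adj u z ↔ G.Adj u z := by
    intro u hu z
    rw [memU] at hu
    obtain ⟨k1, k2, k3⟩ := hu
    refine ⟨fun h => h.1, fun h => ⟨h, by simp [k1, k2], ?_⟩⟩
    rw [mem_union]
    rintro (hz | hz)
    · exact k3 ⟨z, hz, h.symm⟩
    · exact k1 ((memS u).2 ⟨z, hz, h⟩)
  have hV : Valid (del G (S ∪ L)) U M := by
    refine ⟨?_, ?_, ?_⟩
    · intro v; rw [memU, memM]; exact fun a b => a.2.2 b.2.2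
    · intro u v h
      have := h.2.1
      rw [mem_union] at this
      rw [memU, memM]; tauto
    · intro u hu
      obtain ⟨a, b, hab, ha, hb⟩ := two u ((memU u).1 hu).2.1
      exact ⟨a, b, hab, (keep u hu a).2 ha, (keep u hu b).2 hb⟩
  have deg2 : ∀ u ∈ U, ∀ a b, N2 (del G (S ∪ L)) u a b → G.degree u = 2 := by
    intro u hu a b h
    rw [← G.card_neighborFinset_eq_degree, ← card_pair h.1]
    congr 1
    ext z
    rw [SimpleGraph.mem_neighborFinset, ← keep u hu z, h.2 z]
    simp
  obtain ⟨D, F, hD, hF, -, hcard⟩ := good_all _ (del G (S ∪ L)) U M hV rfl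
  have hF0 : F = ∅ := by
    rw [eq_empty_iff_forall_notMem]
    intro X hX
    rcases hF X hX with ⟨a, b, c, d, -, ha, hb, -, -, -, -, -, -, -, -, na, nb, -⟩ |
      ⟨m, n, a, b, c, -, -, -, -, hb, hc, -, -, -, -, -, nb, nc⟩
    · exact h3 a b (deg2 a ha _ _ na) (deg2 b hb _ _ nb) ((na.2 b).2 (Or.inr rfl)).1
    · exact h3 b c (deg2 b hb _ _ nb) (deg2 c hc _ _ nc) ((nb.2 c).2 (Or.inr rfl)).1
  refine ⟨D ∪ S, ?_, ?_⟩
  · intro v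
    by_cases hvU : v ∈ U
    · rcases hD v hvU with h | ⟨x, hx, h⟩
      · exact Or.inl (mem_union_left _ h)
      · exact Or.inr ⟨x, mem_union_left _ hx, h.1⟩
    · by_cases hvS : v ∈ S
      · exact Or.inl (mem_union_right _ hvS)
      · right
        by_cases hvL : v ∈ L
        · obtain ⟨w, hw⟩ : ∃ w, G.Adj v w := by
            have := h1 v
            rw [← G.card_neighborFinset_eq_degree] at this
            obtain ⟨w, hw⟩ := card_pos.1 this
            exact ⟨w, by simpa using hw⟩
          exact ⟨w, mem_union_right _ ((memS w).2 ⟨v, hvL, hw.symm⟩), hw.symm⟩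
        · have : v ∈ M := by
            rw [memM]; rw [memU] at hvU; tauto
          obtain ⟨-, -, s, hs, hsv⟩ := (memM v).1 this
          exact ⟨s, mem_union_right _ hs, hsv⟩
  · have hle := card_union_le D S
    rw [hF0, sum_empty] at hcard
    have hfin : 7 * (D ∪ S).card ≤ 3 * Fintype.card V := by omega
    have : (7 : ℚ) * ((D ∪ S).card : ℚ) ≤ 3 * (Fintype.card V : ℚ) := by exact_mod_cast hfin
    linarith
end

section
/- For every finite simple graph G there exists a vdp-cover S of G with the following properties. Whenever P_i ∈ S is a 1-path or a 2-path, x is an out-endpoint of P_i, y is a neighbor of x lying on a path P_j ∈ S with P_j ≠ P_i, and P_j = P_j′ y P_j″ is the decomposition of P_j at y, then: (B1) P_j is not a 1-path; (B2) if P_j is a 0-path then both P_j′ and P_j″ are 1-paths; (B3) if P_j is a 2-path then both P_j′ and P_j″ are 2-paths; (B4) if |P_j| = 8 then P_i is a 1-path; (B5) if P_j is a 2-path and P_i is a dangling path, then either one of P_j′, P_j″ is a dangling path, or |P_j| ∈ {11, 17} and |P_j′| = |P_j″|; (B6) if P_j is a 2-path and z is the endpoint of P_j lying in P_j′, then every neighbor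 of z lying on P_j″ is a (2,2)-vertex of P_j. Moreover, (B7) every 0-path in S has order 3. -/
/-- A path of `G`, modelled as a nonempty duplicate-free list of vertices whose
consecutive entries are adjacent. Its order (number of vertices) is `l.length`;
it is an `i`-path when `l.length % 3 = i`. -/
def IsPathList {V : Type*} (G : SimpleGraph V) (l : List V) : Prop :=
  l ≠ [] ∧ l.Nodup ∧ l.Chain' G.Adj

/-- A vdp-cover of `G`: a set of pairwise vertex-disjoint paths covering all vertices. -/
def VdpCover {V : Type*} (G : SimpleGraph V) (S : Finset (List V)) : Prop :=
  (∀ l ∈ S, IsPathList G l) ∧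
  (∀ l ∈ S, ∀ l' ∈ S, l ≠ l' → ∀ x : V, x ∈ l → x ∉ l') ∧
  (∀ v : V, ∃ l ∈ S, v ∈ l)

/-- `x` is an endpoint of the path `l`. -/
def IsEndpoint {V : Type*} (l : List V) (x : V) : Prop :=
  l.head? = some x ∨ l.getLast? = some x

/-- `x` is an out-endpoint of the path `l`: an endpoint with a neighbor outside `l`. -/
def IsOutEndpoint {V : Type*} (G : SimpleGraph V) (l : List V) (x : V) : Prop :=
  IsEndpoint l x ∧ ∃ z : V, z ∉ l ∧ G.Adj x z

/-- A dangling path of `G`: a path of order two exactly one of whose endpoints has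
degree 1 in `G`. -/
def Dangling {V : Type*} [Fintype V] (G : SimpleGraph V) [DecidableRel G.Adj]
    (l : List V) : Prop :=
  ∃ u w : V, l = [u, w] ∧ G.Adj u w ∧
    ((G.degree u = 1 ∧ G.degree w ≠ 1) ∨ (G.degree u ≠ 1 ∧ G.degree w = 1))

/-- `x` is a `(2,2)`-vertex of the path `l`: deleting `x` splits `l` into two paths,
each of order `≡ 2 (mod 3)`. -/
def Is22Vertex {V : Type*} (l : List V) (x : V) : Prop :=
  ∃ l₁ l₂ : List V, l = l₁ ++ x :: l₂ ∧ l₁.length % 3 = 2 ∧ l₂.length % 3 = 2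


/-- Number of non-zero paths weight. -/
def wOne {V : Type*} (l : List V) : ℕ := if l.length % 3 = 0 then 0 else 1

open Classical in
/-- Secondary weight. -/
noncomputable def wTwo {V : Type*} [Fintype V] (G : SimpleGraph V) [DecidableRel G.Adj]
    (l : List V) : ℕ :=
  if l.length % 3 = 0 then l.length ^ 2 else if l.length % 3 = 1 then l.length else
    (if l.length = 8 then 2 else 0) + (if Dangling G l then 1 else 0)

/-- Covers as lists of (possibly empty) paths. -/
def LCover {V : Type*} (G : SimpleGraph V) (L : List (List V)) : Prop :=
  (∀ l ∈ L, l.IsChain G.Adj) ∧ L.flatten.Nodup ∧ ∀ v, v ∈ L.flatten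

/-- First total cost. -/
def costOne {V : Type*} (L : List (List V)) : ℕ := (L.map wOne).sum

/-- Second total cost. -/
noncomputable def costTwo {V : Type*} [Fintype V] (G : SimpleGraph V) [DecidableRel G.Adj]
    (L : List (List V)) : ℕ := (L.map (wTwo G)).sum

/-- Optimal covers. -/
def LOpt {V : Type*} [Fintype V] (G : SimpleGraph V) [DecidableRel G.Adj]
    (L : List (List V)) : Prop :=
  LCover G L ∧ ∀ M, LCover G M →
    costOne L ≤ costOne M ∧ (costOne M = costOne L → costTwo G L ≤ costTwo G M)

set_option linter.unusedSectionVars false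

section aux
variable {V : Type*} [Fintype V] [DecidableEq V] (G : SimpleGraph V) [DecidableRel G.Adj]

theorem exists_lopt : ∃ L, LOpt G L := by
  have hne : ∃ L, LCover G L := by
    refine ⟨Finset.univ.toList.map (fun v => [v]), ?_, ?_, ?_⟩
    · intro l hl
      simp only [List.mem_map] at hl
      obtain ⟨v, _, rfl⟩ := hl
      simp
    · have : (Finset.univ.toList.map (fun v : V => [v])).flatten = Finset.univ.toList := by
        rw [← List.flatMap_def]; simp
      rw [this]; exact Finset.nodup_toList _
    · intro v; simp
  obtain ⟨L, hL, hmin⟩ := WellFounded.has_min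
    (InvImage.wf (fun L : List (List V) => toLex (costOne L, costTwo G L)) wellFounded_lt)
    {L | LCover G L} hne
  refine ⟨L, hL, fun M hM => ?_⟩
  have := hmin M hM
  simp only [InvImage, Prod.Lex.toLex_lt_toLex] at this
  push Not at this
  refine ⟨this.1, fun h => this.2 h⟩

variable {G}

theorem LCover.exch {L R : List (List V)} {O N : List (List V)} (hL : LCover G L)
    (hp : L.Perm (O ++ R)) (hf : N.flatten.Perm O.flatten) (hc : ∀ l ∈ N, l.IsChain G.Adj) :
    LCover G (N ++ R) := by
  obtain ⟨h1, h2, h3⟩ := hL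
  have hfl : (N ++ R).flatten.Perm L.flatten := by
    refine List.Perm.trans ?_ hp.symm.flatten
    simp only [List.flatten_append]
    exact hf.append_right _
  refine ⟨?_, hfl.nodup_iff.2 h2, fun v => hfl.mem_iff.2 (h3 v)⟩
  intro l hl
  rcases List.mem_append.1 hl with h | h
  · exact hc l h
  · exact h1 l (hp.mem_iff.2 (List.mem_append_right _ h))

theorem costOne_perm {L O R : List (List V)} (hp : L.Perm (O ++ R)) :
    costOne L = costOne O + costOne R := by
  unfold costOne
  rw [(hp.map _).sum_eq]; simp

theorem costTwo_perm {L O R : List (List V)} (hp : L.Perm (O ++ R)) :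
    costTwo G L = costTwo G O + costTwo G R := by
  unfold costTwo
  rw [(hp.map _).sum_eq]; simp

theorem LOpt.exch {L R : List (List V)} {O N : List (List V)} (hL : LOpt G L)
    (hp : L.Perm (O ++ R)) (hf : N.flatten.Perm O.flatten) (hc : ∀ l ∈ N, l.IsChain G.Adj) :
    costOne O ≤ costOne N ∧ (costOne N = costOne O → costTwo G O ≤ costTwo G N) := by
  have h := hL.2 _ (hL.1.exch hp hf hc)
  have e1 := costOne_perm hp
  have e2 := costTwo_perm (G := G) hp
  have e3 := costOne_perm (List.Perm.refl (N ++ R))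
  have e4 := costTwo_perm (G := G) (List.Perm.refl (N ++ R))
  rw [e1, e2, e3, e4] at h
  omega

theorem two_perm {L : List (List V)} {P Q : List V} (hP : P ∈ L) (hQ : Q ∈ L) (h : P ≠ Q) :
    ∃ R, L.Perm ([P, Q] ++ R) := by
  refine ⟨(L.erase P).erase Q, ?_⟩
  have h1 := List.perm_cons_erase hP
  have h2 := List.perm_cons_erase ((List.mem_erase_of_ne h.symm).2 hQ)
  exact h1.trans (h2.cons P)

theorem chain_rev {l : List V} (h : l.IsChain G.Adj) : l.reverse.IsChain G.Adj := by
  rw [List.isChain_reverse]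
  exact h.imp (fun a b hab => hab.symm)

/-- Orientation: `x` made the last vertex. -/
theorem orient {P : List V} {x : V} (hc : P.IsChain G.Adj) (hx : IsEndpoint P x) :
    ∃ P₀ : List V, P₀.Perm P ∧ P₀.IsChain G.Adj ∧ P₀.getLast? = some x := by
  rcases hx with h | h
  · exact ⟨P.reverse, List.reverse_perm P, chain_rev hc, by simpa using h⟩
  · exact ⟨P, List.Perm.refl _, hc, h⟩

/-- The core exchange. -/
theorem LOpt.core {L : List (List V)} (hL : LOpt G L) {P Q : List V} (hP : P ∈ L) (hQ : Q ∈ L)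
    (hne : P ≠ Q) {x y : V} (hx : IsEndpoint P x) (hxy : G.Adj x y) {Q₁ Q₂ : List V}
    (hQe : Q = Q₁ ++ y :: Q₂) :
    (∃ A : List V, A.length = P.length + 1 + Q₂.length ∧
      wOne P + wOne Q ≤ wOne A + wOne Q₁ ∧ (wOne A + wOne Q₁ = wOne P + wOne Q →
        wTwo G P + wTwo G Q ≤ wTwo G A + wTwo G Q₁)) ∧
    (∃ A : List V, A.length = P.length + 1 + Q₁.length ∧
      wOne P + wOne Q ≤ wOne A + wOne Q₂ ∧ (wOne A + wOne Q₂ = wOne P + wOne Q →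
        wTwo G P + wTwo G Q ≤ wTwo G A + wTwo G Q₂)) := by
  obtain ⟨R, hR⟩ := two_perm hP hQ hne
  obtain ⟨P₀, hp, hc, hl⟩ := orient (hL.1.1 P hP) hx
  have hcQ := hL.1.1 Q hQ
  rw [hQe, List.isChain_append] at hcQ
  obtain ⟨c1, c2, c3⟩ := hcQ
  constructor
  · refine ⟨P₀ ++ y :: Q₂, by simp [hp.length_eq]; omega, ?_⟩
    have := hL.exch hR (N := [P₀ ++ y :: Q₂, Q₁]) ?_ ?_
    · simpa [costOne, costTwo] using this
    · subst hQe
      rw [List.perm_iff_count]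
      intro a
      have := hp.count_eq a
      simp [List.count_cons, this]
      omega
    · intro l hl'
      simp only [List.mem_cons, List.not_mem_nil, or_false] at hl'
      rcases hl' with rfl | rfl
      · refine List.isChain_append.2 ⟨hc, c2, ?_⟩
        intro a ha b hb
        rw [hl] at ha
        simp at ha hb
        subst ha; subst hb; exact hxy
      · exact c1
  · have c4 : (Q₁ ++ [y]).IsChain G.Adj := by
      refine List.isChain_append.2 ⟨c1, by simp, ?_⟩
      intro a ha b hb
      exact c3 a ha b (by simpa using hb)
    have c5 := chain_rev c4
    simp only [List.reverse_append, List.reverse_cons, List.reverse_nil, List.nil_append,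
      List.singleton_append] at c5
    refine ⟨P₀ ++ y :: Q₁.reverse, by simp [hp.length_eq]; omega, ?_⟩
    have := hL.exch hR (N := [P₀ ++ y :: Q₁.reverse, Q₂]) ?_ ?_
    · simpa [costOne, costTwo] using this
    · subst hQe
      rw [List.perm_iff_count]
      intro a
      have := hp.count_eq a
      simp [List.count_cons, this]
      omega
    · intro l hl'
      simp only [List.mem_cons, List.not_mem_nil, or_false] at hl'
      rcases hl' with rfl | rfl
      · refine List.isChain_append.2 ⟨hc, c5, ?_⟩
        intro a ha b hb
        rw [hl] at ha
        simp at ha hb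
        subst ha; subst hb; exact hxy
      · exact c2.tail

theorem wOne_zero {l : List V} (h : l.length % 3 = 0) : wOne l = 0 := by simp [wOne, h]

theorem wOne_pos {l : List V} (h : l.length % 3 ≠ 0) : wOne l = 1 := by simp [wOne, h]

theorem wTwo_zero {l : List V} (h : l.length % 3 = 0) : wTwo G l = l.length ^ 2 := by
  simp [wTwo, h]

theorem wTwo_one {l : List V} (h : l.length % 3 = 1) : wTwo G l = l.length := by
  simp [wTwo, h]

theorem not_dangling {l : List V} (h : l.length ≠ 2) : ¬ Dangling G l := by
  rintro ⟨u, w, rfl, _⟩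
  simp at h

open Classical in
theorem wTwo_two {l : List V} (h : l.length % 3 = 2) : wTwo G l =
    (if l.length = 8 then 2 else 0) + (if Dangling G l then 1 else 0) := by
  simp [wTwo, h]

theorem wTwo_two_le {l : List V} (h : l.length % 3 = 2) (h2 : l.length ≠ 2) :
    wTwo G l = (if l.length = 8 then 2 else 0) := by
  simp [wTwo_two h, not_dangling h2]

theorem wOne_le (l : List V) : wOne l ≤ 1 := by unfold wOne; split <;> omega

/-- (B1)–(B3). -/
theorem LOpt.b123 {L : List (List V)} (hL : LOpt G L) {P Q : List V} (hP : P ∈ L) (hQ : Q ∈ L)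
    (hne : P ≠ Q) (hP3 : P.length % 3 = 1 ∨ P.length % 3 = 2)
    {x y : V} (hx : IsEndpoint P x) (hxy : G.Adj x y) {Q₁ Q₂ : List V}
    (hQe : Q = Q₁ ++ y :: Q₂) :
    (Q.length % 3 ≠ 1) ∧ (Q.length % 3 = 0 → Q₁.length % 3 = 1 ∧ Q₂.length % 3 = 1) ∧
    (Q.length % 3 = 2 → Q₁.length % 3 = 2 ∧ Q₂.length % 3 = 2) := by
  obtain ⟨⟨A, hA, hA1, hA2⟩, ⟨B, hB, hB1, hB2⟩⟩ := hL.core hP hQ hne hx hxy hQe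
  have hlen : Q.length = Q₁.length + 1 + Q₂.length := by rw [hQe]; simp; omega
  have wA := wOne_le A
  have wB := wOne_le B
  have hwP : wOne P = 1 := wOne_pos (by omega)
  have key : ∀ C T U : List V, C.length = P.length + 1 + U.length →
      Q.length = T.length + 1 + U.length →
      (wOne C + wOne T = wOne P + wOne Q → wTwo G P + wTwo G Q ≤ wTwo G C + wTwo G T) →
      ¬ (Q.length % 3 = 1 ∧ P.length % 3 = 2 ∧ T.length % 3 = 1) ∧
      ¬ (Q.length % 3 = 0 ∧ T.length % 3 = 0) := by
    intro C T U h1 h2 h3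
    constructor
    · rintro ⟨e1, e2, e3⟩
      have hC : C.length % 3 = 2 := by omega
      rw [wOne_pos (l := C) (by omega), wOne_pos (l := T) (by omega), hwP,
        wOne_pos (l := Q) (by omega), wTwo_one e1, wTwo_one e3,
        wTwo_two_le hC (by omega)] at h3
      have := h3 rfl
      split_ifs at this <;> omega
    · rintro ⟨e1, e2⟩
      have hC : C.length % 3 = P.length % 3 := by omega
      rw [wOne_pos (l := C) (by omega), wOne_zero (l := T) (by omega), hwP,
        wOne_zero (l := Q) (by omega), wTwo_zero e1, wTwo_zero e2] at h3
      have := h3 rfl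
      have hU : 2 ≤ U.length := by omega
      have hsq : T.length ^ 2 + 3 * (U.length + 1) ≤ (T.length + 1 + U.length) ^ 2 := by
        nlinarith [Nat.zero_le (T.length * U.length)]
      rcases hP3 with h | h
      · rw [wTwo_one h, wTwo_one (hC.trans h), h1, h2] at this
        linarith
      · rw [wTwo_two_le (hC.trans h) (by omega), h2] at this
        split_ifs at this <;> linarith [Nat.zero_le (wTwo G P)]
  have k1 := key A Q₁ Q₂ hA hlen hA2
  have k2 := key B Q₂ Q₁ hB (by omega) hB2
  have z : ∀ l : List V, l.length % 3 = 0 → wOne l = 0 := fun l h => wOne_zero h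
  have p : ∀ l : List V, l.length % 3 ≠ 0 → wOne l = 1 := fun l h => wOne_pos h
  have zA := z A; have zB := z B; have zQ := z Q; have z1 := z Q₁; have z2 := z Q₂
  have pA := p A; have pB := p B; have pQ := p Q; have p1 := p Q₁; have p2 := p Q₂
  refine ⟨?_, ?_, ?_⟩ <;> omega

/-- (B4). -/
theorem LOpt.b4 {L : List (List V)} (hL : LOpt G L) {P Q : List V} (hP : P ∈ L) (hQ : Q ∈ L)
    (hne : P ≠ Q) (hP3 : P.length % 3 = 1 ∨ P.length % 3 = 2)
    {x y : V} (hx : IsEndpoint P x) (hxy : G.Adj x y) {Q₁ Q₂ : List V}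
    (hQe : Q = Q₁ ++ y :: Q₂) (h8 : Q.length = 8) : P.length % 3 = 1 := by
  by_contra hP1
  have hP2 : P.length % 3 = 2 := by omega
  obtain ⟨h1, h2⟩ := (hL.b123 hP hQ hne hP3 hx hxy hQe).2.2 (by omega)
  obtain ⟨⟨A, hA, hA1, hA2⟩, ⟨B, hB, hB1, hB2⟩⟩ := hL.core hP hQ hne hx hxy hQe
  have hlen : Q.length = Q₁.length + 1 + Q₂.length := by rw [hQe]; simp; omega
  rw [wOne_pos (l := A) (by omega), wOne_pos (l := Q₁) (by omega), wOne_pos (l := Q) (by omega),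
    wOne_pos (l := P) (by omega)] at hA2
  rw [wOne_pos (l := B) (by omega), wOne_pos (l := Q₂) (by omega), wOne_pos (l := Q) (by omega),
    wOne_pos (l := P) (by omega)] at hB2
  have hA3 := hA2 rfl
  have hB3 := hB2 rfl
  rw [wTwo_two (l := A) (by omega), wTwo_two (l := Q₁) (by omega), wTwo_two (l := P) (by omega),
    wTwo_two (l := Q) (by omega), if_pos h8] at hA3
  rw [wTwo_two (l := B) (by omega), wTwo_two (l := Q₂) (by omega), wTwo_two (l := P) (by omega),
    wTwo_two (l := Q) (by omega), if_pos h8] at hB3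
  rw [if_neg (not_dangling (G := G) (l := A) (by omega))] at hA3
  rw [if_neg (not_dangling (G := G) (l := B) (by omega))] at hB3
  split_ifs at hA3 hB3 <;> omega

/-- (B5). -/
theorem LOpt.b5 {L : List (List V)} (hL : LOpt G L) {P Q : List V} (hP : P ∈ L) (hQ : Q ∈ L)
    (hne : P ≠ Q) (hP3 : P.length % 3 = 1 ∨ P.length % 3 = 2)
    {x y : V} (hx : IsEndpoint P x) (hxy : G.Adj x y) {Q₁ Q₂ : List V}
    (hQe : Q = Q₁ ++ y :: Q₂) (hQ2 : Q.length % 3 = 2) (hd : Dangling G P) :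
    Dangling G Q₁ ∨ Dangling G Q₂ ∨
      ((Q.length = 11 ∨ Q.length = 17) ∧ Q₁.length = Q₂.length) := by
  by_contra hcon
  push Not at hcon
  obtain ⟨d1, d2, d3⟩ := hcon
  have hPl : P.length = 2 := by by_contra h; exact not_dangling h hd
  have h8 : Q.length ≠ 8 := by
    intro h
    have := hL.b4 hP hQ hne hP3 hx hxy hQe h
    omega
  obtain ⟨h1, h2⟩ := (hL.b123 hP hQ hne hP3 hx hxy hQe).2.2 (by omega)
  obtain ⟨⟨A, hA, hA1, hA2⟩, ⟨B, hB, hB1, hB2⟩⟩ := hL.core hP hQ hne hx hxy hQe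
  have hlen : Q.length = Q₁.length + 1 + Q₂.length := by rw [hQe]; simp; omega
  rw [wOne_pos (l := A) (by omega), wOne_pos (l := Q₁) (by omega), wOne_pos (l := Q) (by omega),
    wOne_pos (l := P) (by omega)] at hA2
  rw [wOne_pos (l := B) (by omega), wOne_pos (l := Q₂) (by omega), wOne_pos (l := Q) (by omega),
    wOne_pos (l := P) (by omega)] at hB2
  have hA3 := hA2 rfl
  have hB3 := hB2 rfl
  rw [wTwo_two (l := A) (by omega), wTwo_two (l := Q₁) (by omega), wTwo_two (l := P) (by omega),
    wTwo_two (l := Q) (by omega), if_neg h8, if_neg d1, if_pos hd] at hA3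
  rw [wTwo_two (l := B) (by omega), wTwo_two (l := Q₂) (by omega), wTwo_two (l := P) (by omega),
    wTwo_two (l := Q) (by omega), if_neg h8, if_neg d2, if_pos hd] at hB3
  rw [if_neg (not_dangling (G := G) (l := A) (by omega))] at hA3
  rw [if_neg (not_dangling (G := G) (l := B) (by omega))] at hB3
  split_ifs at hA3 hB3 <;> omega

theorem LCover.disj {L : List (List V)} (hL : LCover G L) {P Q : List V} (hP : P ∈ L)
    (hQ : Q ∈ L) (hne : P ≠ Q) {v : V} (hv : v ∈ P) : v ∉ Q := by
  obtain ⟨R, hR⟩ := two_perm hP hQ hne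
  have := hR.flatten.nodup_iff.1 hL.2.1
  simp only [List.cons_append, List.nil_append, List.flatten_cons] at this
  have h := (List.nodup_append.1 this).2.2
  intro hvQ
  exact h v hv v (List.mem_append_left _ hvQ) rfl

/-- (B6). -/
theorem LOpt.b6 {L : List (List V)} (hL : LOpt G L) {P Q : List V} (hP : P ∈ L) (hQ : Q ∈ L)
    (hne : P ≠ Q) (hP3 : P.length % 3 = 1 ∨ P.length % 3 = 2)
    {x y : V} (hx : IsEndpoint P x) (hxy : G.Adj x y) {Q₁ Q₂ : List V}
    (hQe : Q = Q₁ ++ y :: Q₂) (hQ2 : Q.length % 3 = 2) {z w : V} (hz : z ∈ Q₁)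
    (hzE : IsEndpoint Q z) (hw : w ∈ Q₂) (hzw : G.Adj z w) : Is22Vertex Q w := by
  obtain ⟨h1, h2⟩ := (hL.b123 hP hQ hne hP3 hx hxy hQe).2.2 hQ2
  have hnd : Q.Nodup := (List.nodup_flatten.1 hL.1.2.1).1 Q hQ
  have hhead : Q₁.head? = some z := by
    rcases hzE with h | h
    · subst hQe
      rcases Q₁ with _ | ⟨a, t⟩
      · simp at hz
      · simpa using h
    · exfalso
      subst hQe
      have hz2 : z ∈ y :: Q₂ := by
        rw [List.getLast?_append_of_ne_nil _ (by simp)] at h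
        exact List.mem_of_getLast? h
      exact (List.nodup_append.1 hnd).2.2 z hz z hz2 rfl
  obtain ⟨W₁, W₂, rfl⟩ := List.append_of_mem hw
  have hcQ := hL.1.1 Q hQ
  have e : Q = (Q₁ ++ y :: W₁) ++ w :: W₂ := by rw [hQe]; simp
  have hcQ' := hcQ
  rw [e, List.isChain_append] at hcQ'
  obtain ⟨c1, c2, -⟩ := hcQ'
  have c3 := chain_rev c1
  obtain ⟨R, hR⟩ := two_perm hQ hP hne.symm
  set Q' : List V := W₁.reverse ++ y :: (Q₁.reverse ++ w :: W₂) with hQ'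
  have hQ'e : Q' = (Q₁ ++ y :: W₁).reverse ++ w :: W₂ := by simp [hQ']
  have hcQ'' : Q'.IsChain G.Adj := by
    rw [hQ'e]
    refine List.isChain_append.2 ⟨c3, c2, ?_⟩
    intro a ha b hb
    rw [List.getLast?_reverse, List.head?_append, hhead] at ha
    simp at ha hb
    subst ha; subst hb; exact hzw
  have hlen : Q'.length = Q.length := by rw [hQ'e, e]; simp; omega
  have hlQ : Q.length ≠ 2 := by
    have := congrArg List.length hQe
    simp at this
    omega
  have hperm : Q'.Perm Q := by
    rw [hQ'e, e]; exact (List.reverse_perm _).append_right _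
  have hcov : LCover G ([Q', P] ++ R) := by
    refine hL.1.exch hR ?_ ?_
    · simpa using hperm.append_right P
    · intro l hl
      simp only [List.mem_cons, List.not_mem_nil, or_false] at hl
      rcases hl with rfl | rfl
      · exact hcQ''
      · exact hL.1.1 _ hP
  have hO : LOpt G ([Q', P] ++ R) := by
    refine ⟨hcov, fun M hM => ?_⟩
    have hw1 : wOne Q' = wOne Q := by unfold wOne; rw [hlen]
    have hw2 : wTwo G Q' = wTwo G Q := by
      rw [wTwo_two_le (by omega) (by omega), wTwo_two_le (by omega) hlQ, hlen]
    have k1 : costOne ([Q', P] ++ R) = costOne L := by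
      rw [costOne_perm hR]; simp [costOne, hw1]; omega
    have k2 : costTwo G ([Q', P] ++ R) = costTwo G L := by
      rw [costTwo_perm hR]; simp [costTwo, hw2]; omega
    rw [k1, k2]
    exact hL.2 M hM
  have hPQ' : P ≠ Q' := by
    intro h
    have : y ∈ P := by rw [h]; simp [hQ']
    exact hL.1.disj hP hQ hne this (by rw [hQe]; simp)
  have hfin := (hO.b123 (by simp) (by simp) hPQ' hP3 hx hxy hQ').2.2 (by omega)
  simp only [List.length_reverse] at hfin
  refine ⟨Q₁ ++ y :: W₁, W₂, e, ?_, ?_⟩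
  · simp; omega
  · simp at h2; omega

/-- (B7). -/
theorem LOpt.b7 {L : List (List V)} (hL : LOpt G L) {P : List V} (hP : P ∈ L) (hne : P ≠ [])
    (h0 : P.length % 3 = 0) : P.length = 3 := by
  by_contra h3
  have hpos : 0 < P.length := List.length_pos_iff.2 hne
  have hR : L.Perm ([P] ++ L.erase P) := List.perm_cons_erase hP
  have hc := hL.1.1 P hP
  have := hL.exch hR (N := [P.take 3, P.drop 3]) (by simp) (by
    intro l hl
    simp only [List.mem_cons, List.not_mem_nil, or_false] at hl
    rcases hl with rfl | rfl
    · exact hc.take 3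
    · exact hc.drop 3)
  have l1 : (P.take 3).length = 3 := by simp; omega
  have l2 : (P.drop 3).length = P.length - 3 := by simp
  simp only [costOne, costTwo, List.map_cons, List.map_nil, List.sum_cons, List.sum_nil,
    add_zero] at this
  rw [wOne_zero h0, wOne_zero (l := P.take 3) (by omega), wOne_zero (l := P.drop 3) (by omega),
    wTwo_zero h0, wTwo_zero (l := P.take 3) (by omega), wTwo_zero (l := P.drop 3) (by omega),
    l1, l2] at this
  have h := this.2 rfl
  obtain ⟨m, hm⟩ : ∃ m, P.length = m + 3 := ⟨P.length - 3, by omega⟩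
  rw [hm] at h
  simp only [Nat.add_sub_cancel] at h
  have : 0 < m := by omega
  nlinarith

end aux

/-- Every graph has a vdp-cover satisfying properties (B1)–(B7): for every 1-path or
2-path `Pi` of the cover with an out-endpoint `x`, and every neighbor `y` of `x` on a
different path `Pj = P' ++ y :: P''` of the cover, (B1) `Pj` is not a 1-path; (B2) if
`Pj` is a 0-path then `P'` and `P''` are 1-paths; (B3) if `Pj` is a 2-path then `P'`
and `P''` are 2-paths; (B4) if `|Pj| = 8` then `Pi` is a 1-path; (B5) if `Pj` is a
2-path and `Pi` is dangling then one of `P'`, `P''` is dangling, or `|Pj| ∈ {11, 17}`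
and `|P'| = |P''|`; (B6) if `Pj` is a 2-path and `z` is the endpoint of `Pj` lying in
`P'`, then every neighbor of `z` on `P''` is a `(2,2)`-vertex of `Pj`. Moreover (B7)
every 0-path of the cover has order 3. -/
theorem exists_good_vdp_cover {V : Type*} [Fintype V] [DecidableEq V]
    (G : SimpleGraph V) [DecidableRel G.Adj] :
    ∃ S : Finset (List V), VdpCover G S ∧
      (∀ Pi ∈ S, ∀ Pj ∈ S, Pi ≠ Pj →
        (Pi.length % 3 = 1 ∨ Pi.length % 3 = 2) →
        ∀ x : V, IsOutEndpoint G Pi x →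
        ∀ y ∈ Pj, G.Adj x y →
        ∀ P' P'' : List V, Pj = P' ++ y :: P'' →
          (Pj.length % 3 ≠ 1) ∧
          (Pj.length % 3 = 0 → P'.length % 3 = 1 ∧ P''.length % 3 = 1) ∧
          (Pj.length % 3 = 2 → P'.length % 3 = 2 ∧ P''.length % 3 = 2) ∧
          (Pj.length = 8 → Pi.length % 3 = 1) ∧
          (Pj.length % 3 = 2 → Dangling G Pi →
            (Dangling G P' ∨ Dangling G P'' ∨
              ((Pj.length = 11 ∨ Pj.length = 17) ∧ P'.length = P''.length))) ∧
          (Pj.length % 3 = 2 →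
            ∀ z ∈ P', IsEndpoint Pj z →
              ∀ w ∈ P'', G.Adj z w → Is22Vertex Pj w)) ∧
      (∀ P ∈ S, P.length % 3 = 0 → P.length = 3) := by
  obtain ⟨L, hL⟩ := exists_lopt G
  have hmem : ∀ l, l ∈ (L.filter (fun l => l ≠ [])).toFinset ↔ l ∈ L ∧ l ≠ [] := by
    intro l; simp
  refine ⟨(L.filter (fun l => l ≠ [])).toFinset, ⟨?_, ?_, ?_⟩, ?_, ?_⟩
  · intro l hl
    rw [hmem] at hl
    exact ⟨hl.2, (List.nodup_flatten.1 hL.1.2.1).1 l hl.1, hL.1.1 l hl.1⟩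
  · intro l hl l' hl' hne x hx
    rw [hmem] at hl hl'
    exact hL.1.disj hl.1 hl'.1 hne hx
  · intro v
    obtain ⟨l, hl, hv⟩ := List.mem_flatten.1 (hL.1.2.2 v)
    exact ⟨l, (hmem l).2 ⟨hl, List.ne_nil_of_mem hv⟩, hv⟩
  · intro P hP Q hQ hne hP3 x hx y _ hxy Q₁ Q₂ hQe
    rw [hmem] at hP hQ
    obtain ⟨b1, b2, b3⟩ := hL.b123 hP.1 hQ.1 hne hP3 hx.1 hxy hQe
    refine ⟨b1, b2, b3, ?_, ?_, ?_⟩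
    · exact fun h => hL.b4 hP.1 hQ.1 hne hP3 hx.1 hxy hQe h
    · exact fun h hd => hL.b5 hP.1 hQ.1 hne hP3 hx.1 hxy hQe h hd
    · exact fun h z hz hzE w hw hzw =>
        hL.b6 hP.1 hQ.1 hne hP3 hx.1 hxy hQe h hz hzE hw hzw
  · intro P hP h0
    rw [hmem] at hP
    exact hL.b7 hP.1 hP.2 h0
end
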